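/- Let a = b with a ≥ 3 and set p := a² + a − 1 and m := a²(a+1)/2. Then the fine-bidegree decomposition of K_{p,1} satisfies: dim_k K_{p,1}^{(m,m)} = 2; dim_k K_{p,1}^{(u,m)} = 1 for every integer u with 0 < |u − m| < a(a+1)/2; dim_k K_{p,1}^{(m,v)} = 1 for every integer v with 0 < |v − m| < a(a+1)/2; and K_{p,1}^{(u,v)} = 0 for all other (u,v) ∈ ℤ². -/

import Mathlib

open MvPolynomial
open scoped TensorProduct

set_option maxHeartbeats 1600000
set_option synthInstance.maxHeartbeats 400000
set_option maxSynthPendingDepth 3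

noncomputable section

/-- The space of bihomogeneous polynomials in `k[x,y,z,w]` of bidegree `(d, e)`:
all monomials `x^α y^β z^γ w^δ` occurring satisfy `α + β = d` and `γ + δ = e`. -/
def Bihom (k : Type*) [Field k] (d e : ℕ) : Submodule k (MvPolynomial (Fin 4) k) where
  carrier := {f | ∀ m ∈ f.support, m 0 + m 1 = d ∧ m 2 + m 3 = e}
  add_mem' := by
    intro f g hf hg m hm
    rcases Finset.mem_union.mp (MvPolynomial.support_add hm) with h | h
    exacts [hf m h, hg m h]
  zero_mem' := by intro m hm; simp at hm
  smul_mem' := by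
    intro c f hf m hm
    exact hf m (MvPolynomial.support_smul hm)

/-- `RS k a b q` is the degree-`q` part `R_q` of the homogeneous coordinate ring of the
Segre–Veronese embedding of `ℙ¹×ℙ¹` by `O(a)⊠O(b)`: bihomogeneous polynomials of
bidegree `(q*a, q*b)`. -/
abbrev RS (k : Type*) [Field k] (a b q : ℕ) : Submodule k (MvPolynomial (Fin 4) k) :=
  Bihom k (q*a) (q*b)

theorem Bihom.mul_mem' {k : Type*} [Field k] {d e d' e' : ℕ} {f g : MvPolynomial (Fin 4) k}
    (hf : f ∈ Bihom k d e) (hg : g ∈ Bihom k d' e') : f * g ∈ Bihom k (d+d') (e+e') := by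
  intro m hm
  have h := MvPolynomial.support_mul f g hm
  rw [Finset.mem_add] at h
  obtain ⟨m1, h1, m2, h2, rfl⟩ := h
  obtain ⟨e1, e2⟩ := hf m1 h1
  obtain ⟨e3, e4⟩ := hg m2 h2
  constructor <;> simp only [Finsupp.add_apply] <;> omega

/-- Multiplication `R_1 × R_q → R_{q+1}`. -/
def segMul (k : Type*) [Field k] (a b q : ℕ) (v : RS k a b 1) (f : RS k a b q) :
    RS k a b (q+1) := by
  refine ⟨(v : MvPolynomial (Fin 4) k) * (f : MvPolynomial (Fin 4) k), ?_⟩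
  have h := Bihom.mul_mem' v.2 f.2
  rwa [show 1*a + q*a = (q+1)*a by ring, show 1*b + q*b = (q+1)*b by ring] at h

/-- The wedge product of a family of vectors, as an element of the `n`-th exterior power. -/
def wedge (k : Type*) [Field k] {M : Type*} [AddCommGroup M] [Module k M] (n : ℕ)
    (v : Fin n → M) : ⋀[k]^n M :=
  ⟨ExteriorAlgebra.ιMulti k n v, ExteriorAlgebra.ιMulti_range k n (Set.mem_range_self v)⟩

/-- The type of a family of Koszul differentials
`δ_{n+1,q} : Λ^{n+1} V ⊗ R_q → Λ^n V ⊗ R_{q+1}` for the Segre–Veronese ring,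
where `V = R_1`. -/
abbrev KoszulMaps (k : Type*) [Field k] (a b : ℕ) :=
  ∀ n q : ℕ, ((⋀[k]^(n+1) (RS k a b 1)) ⊗[k] (RS k a b q)) →ₗ[k]
      ((⋀[k]^n (RS k a b 1)) ⊗[k] (RS k a b (q+1)))

/-- The defining property of the Koszul differentials:
`δ (v_1∧⋯∧v_p ⊗ f) = Σ_i (−1)^{i+1} v_1∧⋯∧v̂_i∧⋯∧v_p ⊗ v_i·f` (1-indexed signs). -/
def IsKoszul (k : Type*) [Field k] (a b : ℕ) (δ : KoszulMaps k a b) : Prop :=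
  ∀ (n q : ℕ) (v : Fin (n+1) → RS k a b 1) (f : RS k a b q),
    δ n q (wedge k (n+1) v ⊗ₜ[k] f) =
      ∑ i : Fin (n+1), ((-1:k)^(i:ℕ)) •
        (wedge k n (fun j => v (i.succAbove j)) ⊗ₜ[k] segMul k a b q (v i) f)

/-- `Kp1 k a b δ n` is the Koszul cohomology `K_{p,1}` for `p = n+1`:
`ker δ_{p,1} / im δ_{p+1,0}`. -/
abbrev Kp1 (k : Type*) [Field k] (a b : ℕ) (δ : KoszulMaps k a b) (n : ℕ) :=
  LinearMap.ker (δ n 1) ⧸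
    Submodule.comap (LinearMap.ker (δ n 1)).subtype (LinearMap.range (δ (n+1) 0))


/-- The monomial `x^{m 0} y^{m 1} z^{m 2} w^{m 3}` as an element of `Bihom k d e`
(zero if it does not have bidegree `(d, e)`). -/
def monEl (k : Type*) [Field k] (d e : ℕ) (m : Fin 4 → ℕ) : Bihom k d e :=
  if h : m 0 + m 1 = d ∧ m 2 + m 3 = e then
    ⟨MvPolynomial.monomial (Finsupp.equivFunOnFinite.symm m) 1, by
      intro m' hm'
      have hm'' := MvPolynomial.support_monomial_subset hm'
      rw [Finset.mem_singleton] at hm''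
      subst hm''
      simpa using h⟩
  else 0

/-- The fine-bidegree-`(u,v)` component of `Λ^p V ⊗ R_q`: the span of the elements
`v_{(i_1,j_1)} ∧ ⋯ ∧ v_{(i_p,j_p)} ⊗ m` where the `v_{(i,j)} = x^i y^{a-i} z^j w^{b-j}`
are the monomial basis vectors of `V = R_1`, `m` is a monomial of `R_q`, and the total
fine bidegree is `(u, v)`. -/
def fineComp (k : Type*) [Field k] (a b p q : ℕ) (u v : ℤ) :
    Submodule k ((⋀[k]^p (RS k a b 1)) ⊗[k] (RS k a b q)) :=
  Submodule.span k
    { x | ∃ (ij : Fin p → ℕ × ℕ) (m : Fin 4 → ℕ),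
        (∀ t, (ij t).1 ≤ a ∧ (ij t).2 ≤ b) ∧
        (m 0 + m 1 = q * a) ∧ (m 2 + m 3 = q * b) ∧
        ((∑ t, ((ij t).1 : ℤ)) + (m 0 : ℤ) = u) ∧
        ((∑ t, ((ij t).2 : ℤ)) + (m 2 : ℤ) = v) ∧
        x = wedge k p (fun t =>
              (monEl k (1 * a) (1 * b) ![(ij t).1, a - (ij t).1, (ij t).2, b - (ij t).2] :
                RS k a b 1)) ⊗ₜ[k]
            (monEl k (q * a) (q * b) m : RS k a b q) }

/-- The fine-bidegree-`(u,v)` component of `K_{p,1}` (for `p = n+1`): the image in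
`K_{p,1} = ker δ_{p,1} / im δ_{p+1,0}` of the part of `ker δ_{p,1}` of fine
bidegree `(u,v)`. -/
def Kp1Comp (k : Type*) [Field k] (a b : ℕ) (δ : KoszulMaps k a b) (n : ℕ) (u v : ℤ) :
    Submodule k (Kp1 k a b δ n) :=
  Submodule.map
    (Submodule.comap (LinearMap.ker (δ n 1)).subtype (LinearMap.range (δ (n+1) 0))).mkQ
    (Submodule.comap (LinearMap.ker (δ n 1)).subtype (fineComp k a b (n+1) 1 u v))

namespace SegreCross

section Lists

variable {k V I : Type*} [Field k] [AddCommGroup V] [Module k V]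

/-- The product in the exterior algebra of the vectors `e g`, for `g` running through a list. -/
def lp (k : Type*) {V I : Type*} [Field k] [AddCommGroup V] [Module k V] (e : I → V)
    (S : List I) : ExteriorAlgebra k V :=
  (S.map fun g => ExteriorAlgebra.ι k (e g)).prod

/-- Contraction of the exterior algebra by a linear form. -/
def ctr (d : Module.Dual k V) : ExteriorAlgebra k V →ₗ[k] ExteriorAlgebra k V :=
  CliffordAlgebra.contractLeft (Q := (0 : QuadraticForm k V)) d

@[simp] lemma lp_nil (e : I → V) : lp k e [] = 1 := rfl

lemma lp_cons (e : I → V) (g : I) (S : List I) :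
    lp k e (g :: S) = ExteriorAlgebra.ι k (e g) * lp k e S := by
  simp [lp]

lemma lp_singleton (e : I → V) (g : I) : lp k e [g] = ExteriorAlgebra.ι k (e g) := by
  simp [lp]

lemma lp_append (e : I → V) (S T : List I) : lp k e (S ++ T) = lp k e S * lp k e T := by
  simp [lp]

lemma ι_mul_ι_comm (x y : V) :
    ExteriorAlgebra.ι k x * ExteriorAlgebra.ι k y =
      -(ExteriorAlgebra.ι k y * ExteriorAlgebra.ι k x) :=
  eq_neg_of_add_eq_zero_left (ExteriorAlgebra.ι_add_mul_swap x y)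

lemma lp_swap (e : I → V) (g h : I) (S : List I) :
    lp k e (g :: h :: S) = -lp k e (h :: g :: S) := by
  simp only [lp_cons, ← mul_assoc]
  rw [ι_mul_ι_comm, neg_mul]

lemma lp_cons_self (e : I → V) (g : I) (S : List I) : lp k e (g :: g :: S) = 0 := by
  simp only [lp_cons, ← mul_assoc, ExteriorAlgebra.ι_sq_zero, zero_mul]

lemma lp_mul_ι (e : I → V) (v : V) (S : List I) :
    lp k e S * ExteriorAlgebra.ι k v =
      (-1 : k) ^ S.length • (ExteriorAlgebra.ι k v * lp k e S) := by
  induction S with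
  | nil => simp
  | cons g S ih =>
    rw [lp_cons, mul_assoc, ih, mul_smul_comm, ← mul_assoc, ι_mul_ι_comm, neg_mul, smul_neg,
      mul_assoc, List.length_cons, pow_succ, mul_neg_one, neg_smul]

lemma lp_middle (e : I → V) (g : I) (S T : List I) :
    lp k e (S ++ g :: T) = (-1 : k) ^ S.length • lp k e (g :: (S ++ T)) := by
  rw [lp_append, lp_cons, ← mul_assoc, lp_mul_ι, lp_cons, lp_append, smul_mul_assoc, mul_assoc]

lemma lp_perm (e : I → V) {S T : List I} (h : S.Perm T) :
    ∃ s : k, s * s = 1 ∧ lp k e S = s • lp k e T := by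
  induction h with
  | nil => exact ⟨1, by simp⟩
  | cons x _ ih =>
    obtain ⟨s, hs, h⟩ := ih
    exact ⟨s, hs, by rw [lp_cons, h, lp_cons, mul_smul_comm]⟩
  | swap x y l => exact ⟨-1, by simp, by rw [lp_swap, neg_one_smul]⟩
  | trans _ _ ih1 ih2 =>
    obtain ⟨s, hs, h⟩ := ih1
    obtain ⟨s', hs', h'⟩ := ih2
    refine ⟨s * s', ?_, by rw [h, h', mul_smul]⟩
    linear_combination (s' * s') * hs + hs'

lemma lp_eq_zero_of_not_nodup (e : I → V) {S : List I} (h : ¬ S.Nodup) : lp k e S = 0 := by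
  induction S with
  | nil => simp at h
  | cons g S ih =>
    by_cases hS : S.Nodup
    · have hg : g ∈ S := by
        by_contra hg
        exact h (List.nodup_cons.2 ⟨hg, hS⟩)
      obtain ⟨A, B, rfl⟩ := List.append_of_mem hg
      rw [lp_cons, lp_middle, mul_smul_comm, ← lp_cons, lp_cons_self, smul_zero]
    · rw [lp_cons, ih hS, mul_zero]

lemma ctr_ι_mul (d : Module.Dual k V) (v : V) (x : ExteriorAlgebra k V) :
    ctr d (ExteriorAlgebra.ι k v * x) = d v • x - ExteriorAlgebra.ι k v * ctr d x :=
  CliffordAlgebra.contractLeft_ι_mul d v x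

lemma ctr_one (d : Module.Dual k V) : ctr d (1 : ExteriorAlgebra k V) = 0 :=
  CliffordAlgebra.contractLeft_one _ d

lemma ctr_ctr (d : Module.Dual k V) (x : ExteriorAlgebra k V) : ctr d (ctr d x) = 0 :=
  CliffordAlgebra.contractLeft_contractLeft d x

lemma ctr_lp_cons (d : Module.Dual k V) (e : I → V) (g : I) (S : List I) :
    ctr d (lp k e (g :: S)) =
      d (e g) • lp k e S - ExteriorAlgebra.ι k (e g) * ctr d (lp k e S) := by
  rw [lp_cons, ctr_ι_mul]

lemma ctr_lp_mul (d : Module.Dual k V) (e : I → V) (S : List I) (x : ExteriorAlgebra k V) :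
    ctr d (lp k e S * x) = ctr d (lp k e S) * x + (-1 : k) ^ S.length • (lp k e S * ctr d x) := by
  induction S with
  | nil => simp [ctr_one]
  | cons g S ih =>
    rw [lp_cons, mul_assoc, ctr_ι_mul, ih, ctr_ι_mul, mul_add, sub_mul, smul_mul_assoc,
      mul_smul_comm, List.length_cons, pow_succ, mul_neg_one, neg_smul, mul_assoc, mul_assoc]
    abel

lemma ctr_lp_eq_zero (d : Module.Dual k V) (e : I → V) (S : List I)
    (h : ∀ g ∈ S, d (e g) = 0) : ctr d (lp k e S) = 0 := by
  induction S with
  | nil => simp [ctr_one]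
  | cons g S ih =>
    rw [ctr_lp_cons, h g (by simp), ih fun g hg => h g (by simp [hg])]
    simp

lemma ctr_lp (d : Module.Dual k V) (e : I → V) (S : List I) :
    ctr d (lp k e S) = ∑ i : Fin S.length,
      ((-1 : k) ^ (i : ℕ) * d (e S[i])) • lp k e (S.eraseIdx i) := by
  induction S with
  | nil => simp [ctr_one]
  | cons g S ih =>
    rw [ctr_lp_cons, ih, Finset.mul_sum, sub_eq_add_neg, ← Finset.sum_neg_distrib]
    refine Eq.trans ?_ (Fin.sum_univ_succ (n := S.length) _).symm
    congr 1
    · simp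
    · refine Finset.sum_congr rfl fun i _ => ?_
      simp [lp_cons, pow_succ]

/-- Two functionals that agree on all sublists obtained by removing one element on which `d` does
not vanish agree on the contraction. -/
lemma map_ctr_lp_congr (d d' : Module.Dual k V) (e : I → V) (S : List I)
    {M : Type*} [AddCommGroup M] [Module k M] (f f' : ExteriorAlgebra k V →ₗ[k] M)
    (h : ∀ A g B, S = A ++ g :: B →
      d (e g) • f (lp k e (A ++ B)) = d' (e g) • f' (lp k e (A ++ B))) :
    f (ctr d (lp k e S)) = f' (ctr d' (lp k e S)) := by
  rw [ctr_lp, ctr_lp, map_sum, map_sum]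
  refine Finset.sum_congr rfl fun i _ => ?_
  have hi : (i : ℕ) < S.length := i.2
  have := h (S.take i) S[i] (S.drop (i + 1)) (by simp)
  rw [← List.eraseIdx_eq_take_drop_succ] at this
  rw [map_smul, map_smul, mul_smul, mul_smul, this]

lemma map_ctr_lp_eq_zero (d : Module.Dual k V) (e : I → V) (S : List I)
    {M : Type*} [AddCommGroup M] [Module k M] (f : ExteriorAlgebra k V →ₗ[k] M)
    (h : ∀ A g B, S = A ++ g :: B → d (e g) = 0 ∨ f (lp k e (A ++ B)) = 0) :
    f (ctr d (lp k e S)) = 0 := by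
  rw [map_ctr_lp_congr d d e S f 0, LinearMap.zero_apply]
  intro A g B hS
  rcases h A g B hS with h | h <;> simp [h]

end Lists

section Basis

variable {k V I : Type*} [Field k] [AddCommGroup V] [Module k V] [LinearOrder I]
  (b : Module.Basis I k V)

lemma basis_eq_lp (F : Finset I) :
    ∃ S : List I, S.Nodup ∧ (∀ x, x ∈ F ↔ x ∈ S) ∧ b.ExteriorAlgebra F = lp k b S := by
  refine ⟨List.ofFn (F.orderEmbOfFin rfl), ?_, ?_, ?_⟩
  · exact List.nodup_ofFn.2 (F.orderEmbOfFin rfl).injective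
  · intro x
    rw [List.mem_ofFn, Set.mem_range.symm, Finset.range_orderEmbOfFin, Finset.mem_coe]
  · rw [ExteriorAlgebra.basis_apply_ofCard b rfl, ExteriorAlgebra.ιMulti_family,
      ExteriorAlgebra.ιMulti_apply, lp,
      List.map_ofFn]
    rfl

lemma exists_lp_eq_basis {S : List I} (hS : S.Nodup) {F : Finset I} (hF : ∀ x, x ∈ F ↔ x ∈ S) :
    ∃ s : k, s * s = 1 ∧ lp k b S = s • b.ExteriorAlgebra F := by
  obtain ⟨T, hT, hFT, h⟩ := basis_eq_lp b F
  rw [h]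
  apply lp_perm
  rw [List.perm_ext_iff_of_nodup hS hT]
  intro x
  rw [← hF, hFT]

lemma ext_lp {M : Type*} [AddCommGroup M] [Module k M] {f g : ExteriorAlgebra k V →ₗ[k] M}
    (h : ∀ S : List I, f (lp k b S) = g (lp k b S)) : f = g := by
  refine b.ExteriorAlgebra.ext fun F => ?_
  obtain ⟨T, -, -, hT⟩ := basis_eq_lp b F
  rw [hT]
  exact h _

end Basis

end SegreCross

namespace SegreCross

/-- Sum of the first coordinates. -/
def sc {m n : ℕ} (L : List (Fin m × Fin n)) : ℤ := (L.map fun g => ((g.1 : ℕ) : ℤ)).sum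

/-- Sum of the second coordinates. -/
def sr {m n : ℕ} (L : List (Fin m × Fin n)) : ℤ := (L.map fun g => ((g.2 : ℕ) : ℤ)).sum

section Sums
variable {m n : ℕ} (g : Fin m × Fin n) (L M : List (Fin m × Fin n))
@[simp] lemma sc_nil : sc ([] : List (Fin m × Fin n)) = 0 := rfl
@[simp] lemma sr_nil : sr ([] : List (Fin m × Fin n)) = 0 := rfl
@[simp] lemma sc_cons : sc (g :: L) = ((g.1 : ℕ) : ℤ) + sc L := by simp [sc]
@[simp] lemma sr_cons : sr (g :: L) = ((g.2 : ℕ) : ℤ) + sr L := by simp [sr]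
@[simp] lemma sc_append : sc (L ++ M) = sc L + sc M := by simp [sc]
@[simp] lemma sr_append : sr (L ++ M) = sr L + sr M := by simp [sr]
variable {L M}
lemma sc_perm (h : L.Perm M) : sc L = sc M := (h.map _).sum_eq
lemma sr_perm (h : L.Perm M) : sr L = sr M := (h.map _).sum_eq
end Sums

variable {k V : Type*} [Field k] [AddCommGroup V] [Module k V] {a : ℕ}

/-- The difference of two horizontally adjacent basis vectors. -/
def wv (b : Fin (a + 1) × Fin (a + 1) → V) (x : Fin a × Fin (a + 1)) : V :=
  b (x.1.castSucc, x.2) - b (x.1.succ, x.2)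

/-- Product of a list of horizontal differences and a list of basis vectors. -/
def wl (k : Type*) {V : Type*} [Field k] [AddCommGroup V] [Module k V] {a : ℕ}
    (b : Fin (a + 1) × Fin (a + 1) → V) (W : List (Fin a × Fin (a + 1)))
    (S : List (Fin (a + 1) × Fin (a + 1))) : ExteriorAlgebra k V :=
  lp k (wv b) W * lp k b S

section General
variable (b : Fin (a + 1) × Fin (a + 1) → V)

@[simp] lemma wl_nil (S) : wl k b [] S = lp k b S := by simp [wl]

lemma wl_column (W S) (i : Fin a) (r : Fin (a + 1)) :
    wl k b W ((i.castSucc, r) :: S) - wl k b W ((i.succ, r) :: S) = wl k b (W ++ [(i, r)]) S := by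
  rw [wl, wl, wl, lp_append, lp_singleton, lp_cons, lp_cons, wv, map_sub, mul_sub, sub_mul,
    mul_assoc, mul_assoc]

lemma wl_column_sum (W S) (r : Fin (a + 1)) :
    wl k b W ((0, r) :: S) - wl k b W ((Fin.last a, r) :: S) =
      ∑ i : Fin a, wl k b (W ++ [(i, r)]) S := by
  simp_rw [← wl_column]
  rw [Finset.sum_sub_distrib, sub_eq_sub_iff_add_eq_add,
    ← Fin.sum_univ_succ (fun i => wl k b W ((i, r) :: S)),
    ← Fin.sum_univ_castSucc (fun i => wl k b W ((i, r) :: S))]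

lemma wl_swap (W S) (g h) : wl k b W (g :: h :: S) = -wl k b W (h :: g :: S) := by
  rw [wl, lp_swap, mul_neg, wl]

lemma wl_perm {W W'} (h : W.Perm W') (S) :
    ∃ s : k, s * s = 1 ∧ wl k b W S = s • wl k b W' S := by
  obtain ⟨s, hs, h⟩ := lp_perm (k := k) (wv b) h
  exact ⟨s, hs, by rw [wl, h, smul_mul_assoc, wl]⟩

lemma ctr_wl (d : Module.Dual k V) (hd : ∀ x, d (wv b x) = 0) (W S) :
    ctr d (wl k b W S) = (-1 : k) ^ W.length • (lp k (wv b) W * ctr d (lp k b S)) := by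
  rw [wl, ctr_lp_mul, ctr_lp_eq_zero d _ _ fun g _ => hd g, zero_mul, zero_add]

lemma map_wl_eq_zero {M : Type*} [AddCommGroup M] [Module k M]
    (f : ExteriorAlgebra k V →ₗ[k] M) (W S)
    (hf : ∀ L, L.length = W.length + S.length → sr L = sr W + sr S → sc W + sc S ≤ sc L →
      sc L ≤ sc W + W.length + sc S → f (lp k b L) = 0) : f (wl k b W S) = 0 := by
  suffices H : ∀ (W : List (Fin a × Fin (a + 1))) (S0 : List (Fin (a + 1) × Fin (a + 1))),
      (∀ L, L.length = S0.length + W.length + S.length → sr L = sr S0 + sr W + sr S →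
      sc S0 + sc W + sc S ≤ sc L →
      sc L ≤ sc S0 + sc W + W.length + sc S → f (lp k b L) = 0) →
      f (lp k b S0 * wl k b W S) = 0 by
    simpa using H W [] (by simpa using hf)
  clear hf W
  intro W
  induction W with
  | nil =>
    intro S0 h
    rw [wl_nil, ← lp_append]
    apply h <;> simp
  | cons w W ih =>
    intro S0 h
    have e1 : lp k b S0 * wl k b (w :: W) S =
        lp k b (S0 ++ [(w.1.castSucc, w.2)]) * wl k b W S -
        lp k b (S0 ++ [(w.1.succ, w.2)]) * wl k b W S := by
      rw [wl, wl, lp_append, lp_append, lp_singleton, lp_singleton, lp_cons, wv, map_sub]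
      noncomm_ring
    rw [e1, map_sub, ih, ih, sub_zero]
    all_goals
      intro L h1 h2 h3 h4
      simp at h1 h2 h3 h4
      apply h L <;> simp <;> omega

end General

end SegreCross

namespace SegreCross

variable {k V : Type*} [Field k] [AddCommGroup V] [Module k V] {a : ℕ}

/-- The grid of basis monomials. -/
abbrev Pt (a : ℕ) := Fin (a + 1) × Fin (a + 1)

/-- The linear form taking the value one on all basis vectors. -/
def aug (b : Module.Basis (Pt a) k V) : Module.Dual k V := b.constr k fun _ => (1 : k)

/-- The linear form taking the value one on the basis vectors in the rows `r` and `s`, and zero on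
the other ones. -/
def rowf (b : Module.Basis (Pt a) k V) (r s : Fin (a + 1)) : Module.Dual k V :=
  b.constr k fun g => if g.2 = r ∨ g.2 = s then (1 : k) else 0

/-- Functionals on the exterior algebra dual to Koszul cycles of a given fine bidegree. -/
structure IsCocycle (b : Module.Basis (Pt a) k V) (t₁ t₂ : ℤ)
    (Φ : ExteriorAlgebra k V →ₗ[k] k) : Prop where
  closed : ∀ x, Φ (ctr (aug b) x) = 0
  supp : ∀ S, Φ (lp k b S) ≠ 0 → S.length = a + 2 ∧ t₁ ≤ sc S ∧ sc S ≤ t₁ + a ∧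
    t₂ ≤ sr S ∧ sr S ≤ t₂ + a

section
variable (b : Module.Basis (Pt a) k V)

@[simp] lemma aug_apply (g : Pt a) : aug b (b g) = 1 := by simp [aug]

@[simp] lemma rowf_apply (r s : Fin (a + 1)) (g : Pt a) :
    rowf b r s (b g) = if g.2 = r ∨ g.2 = s then 1 else 0 := by
  rw [rowf, Module.Basis.constr_basis]

lemma aug_wv (x) : aug b (wv b x) = 0 := by simp [wv]

lemma rowf_wv (r s x) : rowf b r s (wv b x) = 0 := by simp [wv]

end

namespace IsCocycle
variable {b : Module.Basis (Pt a) k V} {t₁ t₂ : ℤ} {Φ : ExteriorAlgebra k V →ₗ[k] k}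

lemma wsupp (h : IsCocycle b t₁ t₂ Φ) (W S) (hne : Φ (wl k b W S) ≠ 0) :
    W.length + S.length = a + 2 ∧ t₁ ≤ sc W + W.length + sc S ∧ sc W + sc S ≤ t₁ + a ∧
      t₂ ≤ sr W + sr S ∧ sr W + sr S ≤ t₂ + a := by
  by_contra hcon
  apply hne
  apply map_wl_eq_zero
  intro L h1 h2 h3 h4
  by_contra h5
  have := h.supp L h5
  omega

lemma wclosed (h : IsCocycle b t₁ t₂ Φ) (W S) :
    Φ (lp k (wv b) W * ctr (aug b) (lp k b S)) = 0 := by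
  have := h.closed (wl k b W S)
  rw [ctr_wl _ _ (aug_wv b), map_smul] at this
  exact (smul_eq_zero.1 this).resolve_left (pow_ne_zero _ (by simp))

lemma wclosed_one (h : IsCocycle b t₁ t₂ Φ) (W) : Φ (wl k b W []) = 0 := by
  simpa [ctr_lp_cons, ctr_one, wl] using h.wclosed W [(0, 0)]

lemma wclosed_two (h : IsCocycle b t₁ t₂ Φ) (W g g') :
    Φ (wl k b W [g]) = Φ (wl k b W [g']) := by
  have := h.wclosed W [g', g]
  simp only [ctr_lp_cons, aug_apply, one_smul, lp_nil, ctr_one, mul_zero, sub_zero, mul_sub,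
    map_sub, mul_one, ← lp_singleton (k := k) b] at this
  exact sub_eq_zero.1 this

lemma wclosed_three (h : IsCocycle b t₁ t₂ Φ) (W g₁ g₂ g₃) :
    Φ (wl k b W [g₂, g₃]) - Φ (wl k b W [g₁, g₃]) + Φ (wl k b W [g₁, g₂]) = 0 := by
  have := h.wclosed W [g₁, g₂, g₃]
  simp only [ctr_lp_cons, aug_apply, one_smul, lp_nil, ctr_one, mul_zero, sub_zero, mul_sub,
    map_sub, mul_one] at this
  simp only [wl, lp_cons, lp_nil, mul_one] at this ⊢
  linear_combination this

lemma wclosed_four (h : IsCocycle b t₁ t₂ Φ) (W g₁ g₂ g₃ g₄) :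
    Φ (wl k b W [g₂, g₃, g₄]) - Φ (wl k b W [g₁, g₃, g₄]) + Φ (wl k b W [g₁, g₂, g₄])
      - Φ (wl k b W [g₁, g₂, g₃]) = 0 := by
  have := h.wclosed W [g₁, g₂, g₃, g₄]
  simp only [ctr_lp_cons, aug_apply, one_smul, lp_nil, ctr_one, mul_zero, sub_zero, mul_sub,
    map_sub, mul_one] at this
  simp only [wl, lp_cons, lp_nil, mul_one] at this ⊢
  linear_combination this

lemma rows_of_one (h : IsCocycle b t₁ t₂ Φ) (W g) (hne : Φ (wl k b W [g]) ≠ 0) :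
    W.length = a + 1 ∧ sr W = t₂ := by
  have h0 := h.wsupp W [(0, 0)] (by rwa [← h.wclosed_two W g])
  have h1 := h.wsupp W [(0, Fin.last a)] (by rwa [← h.wclosed_two W g])
  simp at h0 h1
  omega

/-- Moving the first of two points inside a row not equal to the critical one. -/
lemma two_column_fst (h : IsCocycle b t₁ t₂ Φ) (W) (i j r : Fin (a + 1)) (g)
    (hr : sr W + (r : ℕ) ≠ t₂) : Φ (wl k b W [(i, r), g]) = Φ (wl k b W [(j, r), g]) := by
  have key : ∀ i : Fin (a + 1), Φ (wl k b W [(i, r), g]) = Φ (wl k b W [(0, r), g]) := by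
    intro i
    induction i using Fin.induction with
    | zero => rfl
    | succ i ih =>
      rw [← ih, eq_comm, ← sub_eq_zero, ← map_sub, wl_column]
      by_contra hne
      have := (h.rows_of_one _ _ hne).2
      simp at this
      omega
  rw [key, key j]

lemma two_column_snd (h : IsCocycle b t₁ t₂ Φ) (W) (i j r : Fin (a + 1)) (g)
    (hr : sr W + (r : ℕ) ≠ t₂) : Φ (wl k b W [g, (i, r)]) = Φ (wl k b W [g, (j, r)]) := by
  rw [wl_swap, map_neg, h.two_column_fst W i j r g hr, wl_swap, map_neg, neg_neg]

lemma two_eq_zero_of_lt (h : IsCocycle b t₁ t₂ Φ) (W g g') (hg : sr W + (g.2 : ℕ) < t₂)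
    (hg' : sr W + (g'.2 : ℕ) < t₂) : Φ (wl k b W [g, g']) = 0 := by
  have h3 := h.wclosed_three W (0, 0) g g'
  have e1 : Φ (wl k b W [(0, 0), g]) = 0 := by
    by_contra hne
    have := h.wsupp _ _ hne
    simp at this
    omega
  have e2 : Φ (wl k b W [(0, 0), g']) = 0 := by
    by_contra hne
    have := h.wsupp _ _ hne
    simp at this
    omega
  rw [e1, e2] at h3
  simpa using h3

lemma two_eq_zero_of_gt (h : IsCocycle b t₁ t₂ Φ) (W g g') (hg : t₂ < sr W + (g.2 : ℕ))
    (hg' : t₂ < sr W + (g'.2 : ℕ)) : Φ (wl k b W [g, g']) = 0 := by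
  have h3 := h.wclosed_three W (0, Fin.last a) g g'
  have e1 : Φ (wl k b W [(0, Fin.last a), g]) = 0 := by
    by_contra hne
    have := h.wsupp _ _ hne
    simp at this
    omega
  have e2 : Φ (wl k b W [(0, Fin.last a), g']) = 0 := by
    by_contra hne
    have := h.wsupp _ _ hne
    simp at this
    omega
  rw [e1, e2] at h3
  simpa using h3

lemma theta_column (h : IsCocycle b t₁ t₂ Φ) (W) (hl : sr W < t₂) (hr : t₂ < sr W + a)
    (i j i' j') :
    Φ (wl k b W [(i, 0), (j, Fin.last a)]) = Φ (wl k b W [(i', 0), (j', Fin.last a)]) := by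
  rw [h.two_column_fst W i i' 0 _ (by simp; omega),
    h.two_column_snd W j j' (Fin.last a) _ (by simp; omega)]

lemma theta_weight (h : IsCocycle b t₁ t₂ Φ) (W) (hl : sr W < t₂) (hr : t₂ < sr W + a) (i j)
    (hne : Φ (wl k b W [(i, 0), (j, Fin.last a)]) ≠ 0) : W.length = a ∧ sc W + a = t₁ := by
  have h0 := h.wsupp W _ (by rwa [h.theta_column W hl hr i j 0 0] at hne)
  have h1 := h.wsupp W _ (by rwa [h.theta_column W hl hr i j (Fin.last a) (Fin.last a)] at hne)
  simp at h0 h1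
  omega

/-- Vanishing of all the values `θ` makes the two-point functions vanish off the critical row. -/
lemma two_eq_zero (h : IsCocycle b t₁ t₂ Φ) (W g g')
    (hθ : sr W < t₂ → t₂ < sr W + a →
      Φ (wl k b W [(Fin.last a, 0), (Fin.last a, Fin.last a)]) = 0)
    (hg : sr W + (g.2 : ℕ) ≠ t₂) (hg' : sr W + (g'.2 : ℕ) ≠ t₂) :
    Φ (wl k b W [g, g']) = 0 := by
  have key : ∀ g g' : Pt a, sr W + (g.2 : ℕ) < t₂ → t₂ < sr W + (g'.2 : ℕ) →
      Φ (wl k b W [g, g']) = 0 := by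
    intro g g' h1 h2
    have hb := g.2.2
    have hb' := g'.2.2
    have e0 := hθ (by omega) (by omega)
    have e1 := h.two_eq_zero_of_lt W g (Fin.last a, 0) h1 (by simp; omega)
    have e2 := h.two_eq_zero_of_gt W g' (Fin.last a, Fin.last a) h2 (by simp; omega)
    have c1 := h.wclosed_three W g (Fin.last a, 0) (Fin.last a, Fin.last a)
    have c2 := h.wclosed_three W g g' (Fin.last a, Fin.last a)
    rw [e0, e1] at c1
    rw [e2] at c2
    linear_combination c2 - c1
  rcases lt_or_gt_of_ne hg with h1 | h1 <;> rcases lt_or_gt_of_ne hg' with h2 | h2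
  · exact h.two_eq_zero_of_lt W g g' h1 h2
  · exact key g g' h1 h2
  · rw [wl_swap, map_neg, key g' g h2 h1, neg_zero]
  · exact h.two_eq_zero_of_gt W g g' h1 h2

/-- Moving a horizontal difference vertically by one step does not change `θ`. -/
lemma theta_move (h : IsCocycle b t₁ t₂ Φ) (W) (i : Fin a) (j j' : Fin (a + 1))
    (hj : (j' : ℕ) = j + 1) (hl : sr W + (j : ℕ) + 1 < t₂) (hr : t₂ < sr W + (j : ℕ) + a) :
    Φ (wl k b (W ++ [(i, j)]) [(Fin.last a, 0), (Fin.last a, Fin.last a)]) =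
      Φ (wl k b (W ++ [(i, j')]) [(Fin.last a, 0), (Fin.last a, Fin.last a)]) := by
  set R := Fin.last a
  by_cases hw : W.length + 1 = a ∧ sc W + (i : ℕ) + a = t₁
  swap
  · have z : ∀ j₀ : Fin (a + 1), sr W + (j₀ : ℕ) < t₂ → t₂ < sr W + (j₀ : ℕ) + a →
        Φ (wl k b (W ++ [(i, j₀)]) [(R, 0), (R, R)]) = 0 := by
      intro j₀ h1 h2
      by_contra hne
      have := h.theta_weight _ (by simp; omega) (by simp; omega) _ _ hne
      simp at this
      omega
    rw [z j (by omega) (by omega), z j' (by omega) (by omega)]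
  obtain ⟨hlen, hw⟩ := hw
  have hi := i.2
  have LRR : ∀ j₀ : Fin (a + 1), sr W + (j₀ : ℕ) < t₂ → t₂ < sr W + (j₀ : ℕ) + a →
      Φ (wl k b W [(0, j₀), (R, 0), (R, R)]) = Φ (wl k b (W ++ [(i, j₀)]) [(R, 0), (R, R)]) := by
    intro j₀ h1 h2
    have e0 : Φ (wl k b W [(R, j₀), (R, 0), (R, R)]) = 0 := by
      by_contra hne
      have := h.wsupp _ _ hne
      simp [R] at this
      omega
    have e1 := congrArg Φ (wl_column_sum (k := k) b W [(R, 0), (R, R)] j₀)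
    rw [map_sub, e0, sub_zero, map_sum] at e1
    rw [e1, Finset.sum_eq_single i _ (by simp)]
    intro i' _ hne
    by_contra hne'
    have := h.theta_weight _ (by simp; omega) (by simp; omega) _ _ hne'
    simp at this
    exact hne (Fin.ext (by omega))
  have LLL : ∀ j₀ : Fin (a + 1), Φ (wl k b W [(0, j₀), (0, 0), (0, R)]) = 0 := by
    intro j₀
    by_contra hne
    have := h.wsupp _ _ hne
    simp at this
    omega
  have z1 : ∀ j₀ : Fin (a + 1), (j₀ : ℕ) ≤ j + 1 → Φ (wl k b W [(0, j₀), (0, 0), (R, 0)]) = 0 := by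
    intro j₀ h0
    by_contra hne
    have := h.wsupp _ _ hne
    simp at this
    omega
  have z2 : ∀ j₀ : Fin (a + 1), (j : ℕ) ≤ j₀ → Φ (wl k b W [(0, j₀), (0, R), (R, R)]) = 0 := by
    intro j₀ h0
    by_contra hne
    have := h.wsupp _ _ hne
    simp [R] at this
    omega
  have q1 := h.wclosed_four W (0, j) (0, 0) (R, 0) (R, R)
  have q2 := h.wclosed_four W (0, j') (0, 0) (R, 0) (R, R)
  have q3 := h.wclosed_four W (0, j) (0, 0) (0, R) (R, R)
  have q4 := h.wclosed_four W (0, j') (0, 0) (0, R) (R, R)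
  rw [z1 j (by omega)] at q1
  rw [z1 j' (by omega)] at q2
  rw [z2 j le_rfl, LLL] at q3
  rw [z2 j' (by omega), LLL] at q4
  rw [← LRR j (by omega) (by omega), ← LRR j' (by omega) (by omega)]
  linear_combination q2 - q1 + q3 - q4

end IsCocycle
end SegreCross

namespace SegreCross

variable {k V : Type*} [Field k] [AddCommGroup V] [Module k V] {a : ℕ}

/-- Value of a functional on horizontal differences and two opposite corners. -/
def th (b : Module.Basis (Pt a) k V) (Φ : ExteriorAlgebra k V →ₗ[k] k)
    (W : List (Fin a × Fin (a + 1))) : k :=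
  Φ (wl k b W [(Fin.last a, 0), (Fin.last a, Fin.last a)])

/-- One horizontal difference for each pair of consecutive columns. -/
def graphList (f : Fin a → Fin (a + 1)) : List (Fin a × Fin (a + 1)) :=
  (List.finRange a).map fun i => (i, f i)

lemma sr_graphList (f : Fin a → Fin (a + 1)) : sr (graphList f) = ∑ i, ((f i : ℕ) : ℤ) := by
  rw [sr, graphList, List.map_map, ← List.sum_ofFn, List.ofFn_eq_map]
  rfl

lemma two_mul_sum_fin (n : ℕ) : 2 * ∑ i : Fin n, ((i : ℕ) : ℤ) = n * (n - 1) := by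
  induction n with
  | zero => simp
  | succ n ih =>
    rw [Fin.sum_univ_castSucc, mul_add]
    simp only [Fin.val_castSucc, ih, Fin.val_last]
    push_cast
    ring

lemma two_mul_sc_graphList (f : Fin a → Fin (a + 1)) : 2 * sc (graphList f) = a * (a - 1) := by
  rw [← two_mul_sum_fin, sc, graphList, List.map_map, ← List.sum_ofFn, List.ofFn_eq_map]
  rfl

lemma th_perm (b : Module.Basis (Pt a) k V) (Φ : ExteriorAlgebra k V →ₗ[k] k) {W W'}
    (h : W.Perm W') (h0 : th b Φ W = 0) : th b Φ W' = 0 := by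
  obtain ⟨s, -, hs⟩ := wl_perm (k := k) b h.symm [(Fin.last a, 0), (Fin.last a, Fin.last a)]
  rw [th, hs, map_smul]
  rw [th] at h0
  rw [h0, smul_zero]

namespace IsCocycle
variable {b : Module.Basis (Pt a) k V} {t₁ t₂ : ℤ} {Φ : ExteriorAlgebra k V →ₗ[k] k}

lemma theta_dup (ha : 3 ≤ a) (h : IsCocycle b t₁ t₂ Φ) (W i) (n : ℕ) :
    ∀ j₁ j₂ : Fin (a + 1), (j₂ : ℕ) = j₁ + n → sr W + (j₁ : ℕ) + (j₂ : ℕ) < t₂ →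
      t₂ < sr W + (j₁ : ℕ) + (j₂ : ℕ) + a → th b Φ (W ++ [(i, j₁), (i, j₂)]) = 0 := by
  induction n with
  | zero =>
    intro j₁ j₂ hj _ _
    obtain rfl : j₂ = j₁ := Fin.ext hj
    rw [th, wl, lp_append, lp_cons_self, mul_zero, zero_mul, map_zero]
  | succ n ih =>
    intro j₁ j₂ hj h1 h2
    have hj₂ := j₂.2
    by_cases hc : sr W + (j₁ : ℕ) + (j₂ : ℕ) + 1 < t₂
    · have e := ih ⟨j₁ + 1, by omega⟩ j₂ (by simp; omega) (by simp; omega) (by simp; omega)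
      have m := h.theta_move (W ++ [(i, j₂)]) i j₁ ⟨j₁ + 1, by omega⟩ rfl (by simp; omega)
        (by simp; omega)
      have e' : th b Φ ((W ++ [(i, j₂)]) ++ [(i, ⟨j₁ + 1, by omega⟩)]) = 0 := by
        refine th_perm b Φ ?_ e
        simpa using List.Perm.append_left W (List.Perm.swap _ _ [])
      rw [th, ← m] at e'
      refine th_perm b Φ ?_ e'
      simpa using List.Perm.append_left W (List.Perm.swap _ _ [])
    · have e := ih j₁ ⟨j₂ - 1, by omega⟩ (by simp; omega) (by simp; omega) (by simp; omega)
      have m := h.theta_move (W ++ [(i, j₁)]) i ⟨j₂ - 1, by omega⟩ j₂ (by simp; omega)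
        (by simp; omega) (by simp; omega)
      rw [List.append_assoc, List.append_assoc] at m
      exact m.symm.trans e

lemma theta_update (h : IsCocycle b t₁ t₂ Φ) (f : Fin a → Fin (a + 1)) (i : Fin a)
    (j j' : Fin (a + 1)) (hj : (j' : ℕ) = j + 1)
    (hl : sr (graphList (Function.update f i j)) + 1 < t₂)
    (hr : t₂ < sr (graphList (Function.update f i j)) + a) :
    th b Φ (graphList (Function.update f i j)) = 0 ↔
      th b Φ (graphList (Function.update f i j')) = 0 := by
  obtain ⟨A, B, hAB⟩ := List.append_of_mem (List.mem_finRange i)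
  have hnd := List.nodup_finRange a
  rw [hAB] at hnd
  have hiA : i ∉ A := fun hi => by
    have := (List.nodup_append.1 hnd).2.2 i hi i (by simp)
    exact this rfl
  have hiB : i ∉ B := (List.nodup_cons.1 (List.nodup_append.1 hnd).2.1).1
  have perm : ∀ j, (graphList (Function.update f i j)).Perm
      ((A ++ B).map (fun i => (i, f i)) ++ [(i, j)]) := by
    intro j
    rw [graphList, hAB, List.map_append, List.map_cons, Function.update_self]
    have e1 : A.map (fun x => (x, Function.update f i j x)) = A.map fun x => (x, f x) := by
      refine List.map_congr_left fun x hx => ?_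
      rw [Function.update_of_ne]
      rintro rfl
      exact hiA hx
    have e2 : B.map (fun x => (x, Function.update f i j x)) = B.map fun x => (x, f x) := by
      refine List.map_congr_left fun x hx => ?_
      rw [Function.update_of_ne]
      rintro rfl
      exact hiB hx
    rw [e1, e2, List.map_append, List.append_assoc]
    refine List.Perm.append_left _ ?_
    exact (List.perm_append_singleton _ _).symm
  have hsr := sr_perm (perm j)
  simp only [sr_append, sr_cons, sr_nil, add_zero] at hsr
  have m := h.theta_move ((A ++ B).map (fun i => (i, f i))) i j j' hj
    (by simp only [List.map_append, sr_append] at hsr ⊢; omega)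
    (by simp only [List.map_append, sr_append] at hsr ⊢; omega)
  constructor
  · intro h0
    exact th_perm b Φ (perm j').symm (m.symm.trans (th_perm b Φ (perm j) h0))
  · intro h0
    exact th_perm b Φ (perm j).symm (m.trans (th_perm b Φ (perm j') h0))

lemma theta_graph (ha : 3 ≤ a) (h : IsCocycle b t₁ t₂ Φ) (g : Fin a → Fin (a + 1))
    (hg1 : sr (graphList g) < t₂) (hg2 : t₂ < sr (graphList g) + a)
    (hg : th b Φ (graphList g) = 0) (n : ℕ) :
    ∀ f : Fin a → Fin (a + 1), ∑ i, (((f i : ℕ) : ℤ) - ((g i : ℕ) : ℤ)).natAbs = n →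
      sr (graphList f) < t₂ → t₂ < sr (graphList f) + a → th b Φ (graphList f) = 0 := by
  induction n using Nat.strong_induction_on with
  | _ n ih =>
  intro f hn hf1 hf2
  have dist : ∀ (i) (j : Fin (a + 1)), (((j : ℕ) : ℤ) - ((g i : ℕ) : ℤ)).natAbs <
      (((f i : ℕ) : ℤ) - ((g i : ℕ) : ℤ)).natAbs →
      ∑ x, (((Function.update f i j x : ℕ) : ℤ) - ((g x : ℕ) : ℤ)).natAbs < n := by
    intro i j hij
    rw [← hn]
    refine Finset.sum_lt_sum (fun x _ => ?_) ⟨i, Finset.mem_univ _, by simpa using hij⟩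
    by_cases hx : x = i
    · subst hx
      simpa using hij.le
    · simp [hx]
  have srup : ∀ i (j : Fin (a + 1)), sr (graphList (Function.update f i j)) =
      sr (graphList f) + (j : ℕ) - (f i : ℕ) := by
    intro i j
    rw [sr_graphList, sr_graphList, ← Finset.add_sum_erase _ _ (Finset.mem_univ i),
      ← Finset.add_sum_erase _ (fun x => ((f x : ℕ) : ℤ)) (Finset.mem_univ i)]
    rw [Finset.sum_congr (g := fun x => ((f x : ℕ) : ℤ)) rfl]
    · simp
      ring
    · intro x hx
      rw [Function.update_of_ne (Finset.ne_of_mem_erase hx)]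
  by_cases hup : (∃ i, (f i : ℕ) < g i) ∧ sr (graphList f) + 1 < t₂
  · obtain ⟨⟨i, hi⟩, h1⟩ := hup
    have hgi := (g i).2
    let j : Fin (a + 1) := ⟨f i + 1, by omega⟩
    have hjv : (j : ℕ) = f i + 1 := rfl
    have e := ih _ (dist i j (by omega)) _ rfl (by rw [srup]; omega) (by rw [srup]; omega)
    have u := (h.theta_update f i (f i) j rfl (by rw [srup]; omega) (by rw [srup]; omega)).2 e
    rwa [Function.update_eq_self] at u
  by_cases hdn : (∃ i, (g i : ℕ) < f i) ∧ t₂ + 1 < sr (graphList f) + a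
  · obtain ⟨⟨i, hi⟩, h1⟩ := hdn
    have hfi := (f i).2
    let j : Fin (a + 1) := ⟨f i - 1, by omega⟩
    have hjv : (j : ℕ) = f i - 1 := rfl
    have e := ih _ (dist i j (by omega)) _ rfl (by rw [srup]; omega) (by rw [srup]; omega)
    have u := (h.theta_update f i j (f i) (by omega) (by rw [srup]; omega)
      (by rw [srup]; omega)).1 e
    rwa [Function.update_eq_self] at u
  have hle : ∀ i, g i ≤ f i := by
    by_contra hcon
    push Not at hcon
    obtain ⟨i, hi⟩ := hcon
    have h1 : ¬ sr (graphList f) + 1 < t₂ := fun h1 => hup ⟨⟨i, hi⟩, h1⟩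
    have h2 : ∀ x, ¬ (g x : ℕ) < f x := fun x hx => hdn ⟨⟨x, hx⟩, by omega⟩
    have : sr (graphList f) < sr (graphList g) := by
      rw [sr_graphList, sr_graphList]
      refine Finset.sum_lt_sum (fun x _ => ?_) ⟨i, Finset.mem_univ _, ?_⟩
      · have := h2 x
        omega
      · exact_mod_cast hi
    omega
  have heq : ∀ i, g i = f i := by
    by_contra hcon
    push Not at hcon
    obtain ⟨i, hi⟩ := hcon
    have hi' : (g i : ℕ) < f i := lt_of_le_of_ne (hle i) fun h => hi (Fin.ext h)
    have h1 : ¬ t₂ + 1 < sr (graphList f) + a := fun h1 => hdn ⟨⟨i, hi'⟩, h1⟩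
    have : sr (graphList g) < sr (graphList f) := by
      rw [sr_graphList, sr_graphList]
      refine Finset.sum_lt_sum (fun x _ => ?_) ⟨i, Finset.mem_univ _, ?_⟩
      · exact_mod_cast hle x
      · exact_mod_cast hi'
    omega
  rwa [← funext heq]

lemma theta_eq_zero (ha : 3 ≤ a) (h : IsCocycle b t₁ t₂ Φ)
    (hΘ : 2 * t₁ = a * (a + 1) → 0 < t₂ → t₂ < a * (a + 1) → ∃ f : Fin a → Fin (a + 1),
      sr (graphList f) < t₂ ∧ t₂ < sr (graphList f) + a ∧ th b Φ (graphList f) = 0)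
    (W) (h1 : sr W < t₂) (h2 : t₂ < sr W + a) : th b Φ W = 0 := by
  by_contra hne
  obtain ⟨hlen, hw⟩ := h.theta_weight W h1 h2 _ _ hne
  by_cases hnd : (W.map Prod.fst).Nodup
  · have hsurj : ∀ i : Fin a, ∃ j, (i, j) ∈ W := by
      have : (W.map Prod.fst).toFinset = Finset.univ := by
        apply Finset.eq_univ_of_card
        rw [List.toFinset_card_of_nodup hnd, List.length_map, hlen, Fintype.card_fin]
      intro i
      have hi : i ∈ (W.map Prod.fst).toFinset := by rw [this]; simp
      simpa using hi
    choose f hf using hsurj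
    have hp : (graphList f).Perm W := by
      have hnd' : (graphList f).Nodup := by
        refine (List.nodup_finRange a).map ?_
        intro x y hxy
        exact (Prod.ext_iff.1 hxy).1
      have hsub : (graphList f).Subperm W := by
        apply hnd'.subperm
        intro x hx
        simp only [graphList, List.mem_map] at hx
        obtain ⟨i, -, rfl⟩ := hx
        exact hf i
      exact hsub.perm_of_length_le (by simp [graphList, hlen])
    have hs := sr_perm hp
    have hs' := sc_perm hp
    have hs2 := two_mul_sc_graphList f
    have hsr := sr_graphList f
    have hb0 : 0 ≤ sr (graphList f) := by
      rw [hsr]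
      exact Finset.sum_nonneg fun i _ => by positivity
    have hb1 : sr (graphList f) ≤ a * a := by
      rw [hsr]
      refine (Finset.sum_le_card_nsmul _ _ (a : ℤ) fun i _ => ?_).trans (by simp)
      have := (f i).2
      omega
    obtain ⟨g, hg1, hg2, hg⟩ := hΘ (by linear_combination hs2 - 2 * hs' - 2 * hw)
      (by omega) (by nlinarith)
    exact hne (th_perm b Φ hp (h.theta_graph ha g hg1 hg2 hg _ f rfl (by omega) (by omega)))
  · obtain ⟨A, B, C, x, hx⟩ : ∃ A B C : List (Fin a × Fin (a + 1)), ∃ x : (Fin a × Fin (a + 1)) ×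
        (Fin a × Fin (a + 1)), W = A ++ x.1 :: (B ++ x.2 :: C) ∧ x.1.1 = x.2.1 := by
      clear hlen hw hne h1 h2
      induction W with
      | nil => simp at hnd
      | cons w W ih =>
        by_cases hW : (W.map Prod.fst).Nodup
        · have hm : w.1 ∈ W.map Prod.fst := by
            by_contra hm
            exact hnd (by simpa using List.nodup_cons.2 ⟨hm, hW⟩)
          obtain ⟨y, hy, hyw⟩ := List.mem_map.1 hm
          obtain ⟨B, C, rfl⟩ := List.append_of_mem hy
          exact ⟨[], B, C, (w, y), rfl, hyw.symm⟩
        · obtain ⟨A, B, C, x, rfl, hx⟩ := ih hW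
          exact ⟨w :: A, B, C, x, rfl, hx⟩
    obtain ⟨rfl, hx⟩ := hx
    obtain ⟨⟨i, j₁⟩, ⟨i', j₂⟩⟩ := x
    obtain rfl : i = i' := hx
    simp only [sr_append, sr_cons] at h1 h2
    apply hne
    rcases le_total j₁ j₂ with hj | hj
    · have e := h.theta_dup ha (A ++ B ++ C) i (j₂ - j₁) j₁ j₂ (by
        have : (j₁ : ℕ) ≤ j₂ := hj
        omega) (by simp; omega) (by simp; omega)
      refine th_perm b Φ ?_ e
      rw [List.perm_iff_count]
      intro y
      simp [List.count_cons]
      omega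
    · have e := h.theta_dup ha (A ++ B ++ C) i (j₁ - j₂) j₂ j₁ (by
        have : (j₂ : ℕ) ≤ j₁ := hj
        omega) (by simp; omega) (by simp; omega)
      refine th_perm b Φ ?_ e
      rw [List.perm_iff_count]
      intro y
      simp [List.count_cons]
      omega

end IsCocycle
end SegreCross

namespace SegreCross

variable {k V : Type*} [Field k] [AddCommGroup V] [Module k V] {a : ℕ}

namespace IsCocycle
variable {b : Module.Basis (Pt a) k V} {t₁ t₂ : ℤ} {Φ : ExteriorAlgebra k V →ₗ[k] k}

/-- A contraction with a row form vanishes as soon as it is nowhere changed by moving points inside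
their rows. -/
lemma row_ctr_eq_zero_of_column (h : IsCocycle b t₁ t₂ Φ) (ha : 0 < a) (r s W S)
    (hlen : W.length + S.length = a + 3) (hS : 4 ≤ S.length)
    (ih : ∀ i j T, sr (((i, j) : Fin a × Fin (a + 1)) :: W) + sr T = sr W + sr S →
      T.length + 1 = S.length →
      Φ (lp k (wv b) (W ++ [(i, j)]) * ctr (rowf b r s) (lp k b T)) = 0) :
    Φ (lp k (wv b) W * ctr (rowf b r s) (lp k b S)) = 0 := by
  let F : ExteriorAlgebra k V →ₗ[k] k :=
    Φ ∘ₗ LinearMap.mulLeft k (lp k (wv b) W) ∘ₗ ctr (rowf b r s)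
  have hF : ∀ x, F x = Φ (lp k (wv b) W * ctr (rowf b r s) x) := fun _ => rfl
  have step : ∀ (i : Fin a) (j : Fin (a + 1)) T, (j : ℕ) + sr T = sr S → T.length + 1 = S.length →
      F (lp k b ((i.castSucc, j) :: T)) = F (lp k b ((i.succ, j) :: T)) := by
    intro i j T h1 h2
    have e := ih i j T (by simp; omega) h2
    rw [lp_append, lp_singleton] at e
    rw [← sub_eq_zero, ← map_sub, lp_cons, lp_cons, ← sub_mul, ← map_sub, hF]
    change Φ (lp k (wv b) W * ctr (rowf b r s) (ExteriorAlgebra.ι k (wv b (i, j)) * lp k b T)) = 0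
    rw [ctr_ι_mul, rowf_wv, zero_smul, zero_sub, mul_neg, map_neg, ← mul_assoc, e, neg_zero]
  have move0 : ∀ (i : Fin (a + 1)) (j : Fin (a + 1)) T, (j : ℕ) + sr T = sr S →
      T.length + 1 = S.length → F (lp k b ((i, j) :: T)) = F (lp k b ((0, j) :: T)) := by
    intro i j T h1 h2
    induction i using Fin.induction with
    | zero => rfl
    | succ i hi => rw [← hi, ← step i j T h1 h2]
  have move : ∀ (c : Fin (a + 1)) B A, sr A + sr B = sr S → A.length + B.length = S.length →
      F (lp k b (A ++ B)) = F (lp k b (A ++ B.map fun g => (c, g.2))) := by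
    intro c B
    induction B with
    | nil => simp
    | cons g B hB =>
      intro A h1 h2
      simp only [sr_cons, List.length_cons] at h1 h2
      have e := hB (A ++ [(c, g.2)]) (by simp; omega) (by simp; omega)
      simp only [List.append_assoc, List.singleton_append] at e
      rw [List.map_cons, ← e, lp_middle, lp_middle b (c, g.2), map_smul, map_smul,
        show g = (g.1, g.2) from rfl, move0 g.1 _ _ (by simp; omega) (by simp; omega),
        move0 c _ _ (by simp; omega) (by simp; omega)]
  have scmap : ∀ (c : Fin (a + 1)) (B : List (Pt a)), sc (B.map fun g => (c, g.2)) =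
      (c : ℕ) * B.length := by
    intro c B
    induction B with
    | nil => simp
    | cons g B hB =>
      rw [List.map_cons, sc_cons, hB]
      push_cast [List.length_cons]
      ring
  have bound : ∀ c : Fin (a + 1), F (lp k b S) ≠ 0 → t₁ ≤ sc W + W.length + (c : ℕ) * (S.length - 1)
      ∧ sc W + (c : ℕ) * (S.length - 1) ≤ t₁ + a := by
    intro c hne
    rw [← List.nil_append S, move c S [] (by simp) (by simp), List.nil_append] at hne
    by_contra hcon
    apply hne
    refine map_ctr_lp_eq_zero _ _ _ (Φ ∘ₗ LinearMap.mulLeft k (lp k (wv b) W)) ?_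
    intro A g B hAB
    right
    by_contra h2
    have h3 := h.wsupp W (A ++ B) h2
    have h4 := scmap c S
    have h5 := congrArg List.length hAB
    have hg : g.1 = c := by
      have : g ∈ S.map fun g => (c, g.2) := by rw [hAB]; simp
      obtain ⟨x, -, rfl⟩ := List.mem_map.1 this
      rfl
    rw [hAB] at h4
    simp only [sc_append, sc_cons, hg, List.length_append] at h3 h4 h5
    apply hcon
    constructor <;> nlinarith
  rw [← hF]
  by_contra hne
  have b0 := (bound 0 hne).1
  have b1 := (bound (Fin.last a) hne).2
  simp only [Fin.val_zero, Fin.val_last] at b0 b1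
  have hS' : (4 : ℤ) ≤ S.length := by exact_mod_cast hS
  have hl' : (W.length : ℤ) + S.length = a + 3 := by exact_mod_cast hlen
  have : (0 : ℤ) < a := by exact_mod_cast ha
  push_cast at b0
  nlinarith

/-- If all the values `θ` vanish then so do the contractions with row forms. -/
lemma row_ctr_wl (h : IsCocycle b t₁ t₂ Φ) (ha : 0 < a)
    (hz : ∀ W, sr W < t₂ → t₂ < sr W + a → th b Φ W = 0) (r s : Fin (a + 1)) (n : ℕ) :
    ∀ W S, S.length = n → W.length + S.length = a + 3 →
      sr W + sr S = t₂ + (r : ℕ) + (s : ℕ) →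
      Φ (lp k (wv b) W * ctr (rowf b r s) (lp k b S)) = 0 := by
  induction n with
  | zero =>
    intro W S hS _ _
    rw [List.length_eq_zero_iff.1 hS, lp_nil, ctr_one, mul_zero, map_zero]
  | succ n ih =>
    intro W S hS hlen hr
    by_cases h4 : 4 ≤ S.length
    · refine h.row_ctr_eq_zero_of_column ha r s W S hlen h4 fun i j T h1 h2 => ?_
      refine ih _ _ (by omega) (by simp; omega) ?_
      simp at h1 ⊢
      omega
    have deq : ∀ g g' : Pt a, (g.2 : ℕ) + (g'.2 : ℕ) = r + s →
        rowf b r s (b g) = rowf b r s (b g') := by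
      intro g g' hg
      rw [rowf_apply, rowf_apply]
      refine if_congr ?_ rfl rfl
      simp only [Fin.ext_iff]
      omega
    match S, hS, h4 with
    | [g], _, _ =>
      have := h.wclosed_one W
      simp only [wl, lp_nil, mul_one] at this
      rw [ctr_lp_cons, lp_nil, ctr_one, mul_zero, sub_zero, mul_smul_comm, mul_one, map_smul, this,
        smul_zero]
    | [g₁, g₂], _, _ =>
      have e : Φ (lp k (wv b) W * ctr (rowf b r s) (lp k b [g₁, g₂])) =
          rowf b r s (b g₁) * Φ (wl k b W [g₂]) - rowf b r s (b g₂) * Φ (wl k b W [g₁]) := by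
        simp only [ctr_lp_cons, lp_nil, ctr_one, mul_zero, sub_zero, mul_sub,
          map_sub, mul_one, mul_smul_comm, map_smul, smul_eq_mul]
        simp only [wl, lp_cons, lp_nil, mul_one]
      rw [e, h.wclosed_two W g₂ g₁, ← sub_mul]
      by_cases h0 : Φ (wl k b W [g₁]) = 0
      · rw [h0, mul_zero]
      · have h1 := (h.rows_of_one W _ h0).2
        simp at hr
        rw [deq g₁ g₂ (by omega), sub_self, zero_mul]
    | [g₁, g₂, g₃], _, _ =>
      have e : Φ (lp k (wv b) W * ctr (rowf b r s) (lp k b [g₁, g₂, g₃])) =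
          rowf b r s (b g₁) * Φ (wl k b W [g₂, g₃]) - rowf b r s (b g₂) * Φ (wl k b W [g₁, g₃])
          + rowf b r s (b g₃) * Φ (wl k b W [g₁, g₂]) := by
        simp only [ctr_lp_cons, lp_nil, ctr_one, mul_zero, sub_zero, mul_sub,
          map_sub, mul_one, mul_smul_comm, map_smul, smul_eq_mul]
        simp only [wl, lp_cons, lp_nil, mul_one]
        ring
      rw [e]
      have c3 := h.wclosed_three W g₁ g₂ g₃
      have z : ∀ g g' : Pt a, sr W + (g.2 : ℕ) ≠ t₂ → sr W + (g'.2 : ℕ) ≠ t₂ →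
        Φ (wl k b W [g, g']) = 0 := fun g g' => h.two_eq_zero W g g' (hz W)
      simp at hr
      by_cases q1 : sr W + (g₁.2 : ℕ) = t₂
      · rw [deq g₂ g₃ (by omega)]
        by_cases q2 : sr W + (g₂.2 : ℕ) = t₂
        · rw [deq g₁ g₃ (by omega)]
          linear_combination rowf b r s (b g₃) * c3
        by_cases q3 : sr W + (g₃.2 : ℕ) = t₂
        · rw [deq g₁ g₂ (by omega), deq g₂ g₃ (by omega)]
          linear_combination rowf b r s (b g₃) * c3
        rw [z g₂ g₃ q2 q3] at c3 ⊢
        linear_combination rowf b r s (b g₃) * c3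
      by_cases q2 : sr W + (g₂.2 : ℕ) = t₂
      · rw [deq g₁ g₃ (by omega)]
        by_cases q3 : sr W + (g₃.2 : ℕ) = t₂
        · rw [(deq g₁ g₂ (by omega)).symm.trans (deq g₁ g₃ (by omega))]
          linear_combination rowf b r s (b g₃) * c3
        rw [z g₁ g₃ q1 q3] at c3 ⊢
        linear_combination rowf b r s (b g₃) * c3
      by_cases q3 : sr W + (g₃.2 : ℕ) = t₂
      · rw [deq g₁ g₂ (by omega)]
        rw [z g₁ g₂ q1 q2] at c3 ⊢
        linear_combination rowf b r s (b g₂) * c3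
      rw [z g₁ g₂ q1 q2, z g₁ g₃ q1 q3, z g₂ g₃ q2 q3]
      ring
    | _ :: _ :: _ :: _ :: _, _, h5 => exact absurd (by simp) h5

/-- Contractions with row forms vanish. -/
lemma row_ctr (h : IsCocycle b t₁ t₂ Φ) (ha : 0 < a)
    (hz : ∀ W, sr W < t₂ → t₂ < sr W + a → th b Φ W = 0) (r s : Fin (a + 1)) (S)
    (hS : sr S = t₂ + (r : ℕ) + (s : ℕ)) :
    Φ (ctr (rowf b r s) (lp k b S)) = 0 := by
  by_cases hlen : S.length = a + 3
  · simpa using h.row_ctr_wl ha hz r s _ [] S rfl (by simpa using hlen) (by simpa using hS)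
  · refine map_ctr_lp_eq_zero _ _ _ _ fun A g B hAB => Or.inr ?_
    by_contra hne
    have h1 := (h.supp _ hne).1
    rw [hAB] at hlen
    simp at hlen h1
    omega

end IsCocycle
end SegreCross

namespace SegreCross

variable {k V : Type*} [Field k] [AddCommGroup V] [Module k V] {a : ℕ}

/-- A functional on the exterior algebra may be prescribed separately on all the products of basis
vectors. -/
lemma exists_piecewise (b : Module.Basis (Pt a) k V)
    (Ψ : Finset (Pt a) → ExteriorAlgebra k V →ₗ[k] k) :
    ∃ ψ : ExteriorAlgebra k V →ₗ[k] k, ∀ S : List (Pt a), S.Nodup →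
      ψ (lp k b S) = Ψ S.toFinset (lp k b S) := by
  let : LinearOrder (Pt a) := LinearOrder.lift' toLex toLex.injective
  refine ⟨b.ExteriorAlgebra.constr k fun F => Ψ F (b.ExteriorAlgebra F), ?_⟩
  intro S hS
  obtain ⟨s, -, h⟩ := exists_lp_eq_basis b hS (F := S.toFinset) (by simp)
  rw [h, map_smul, Module.Basis.constr_basis, map_smul]

lemma ext_lp_grid (b : Module.Basis (Pt a) k V) {M : Type*} [AddCommGroup M] [Module k M]
    {f g : ExteriorAlgebra k V →ₗ[k] M} (h : ∀ S, f (lp k b S) = g (lp k b S)) : f = g := by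
  let : LinearOrder (Pt a) := LinearOrder.lift' toLex toLex.injective
  exact ext_lp b h

/-- Functionals dual to the chains whose boundary is considered. -/
def IsCochain (b : Module.Basis (Pt a) k V) (t₁ t₂ : ℤ) (ψ : ExteriorAlgebra k V →ₗ[k] k) : Prop :=
  ∀ G, ψ (lp k b G) ≠ 0 → G.length = a + 1 ∧ sc G = t₁ ∧ sr G = t₂

/-- Vanishing of contractions with two-row forms. -/
def RowClosed (b : Module.Basis (Pt a) k V) (t₂ : ℤ) (Φ : ExteriorAlgebra k V →ₗ[k] k) : Prop :=
  ∀ (r s : Fin (a + 1)) (S), sr S = t₂ + (r : ℕ) + (s : ℕ) → Φ (ctr (rowf b r s) (lp k b S)) = 0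

/-- Vanishing on products of basis vectors that avoid some row. -/
def RowFull (b : Module.Basis (Pt a) k V) (Φ : ExteriorAlgebra k V →ₗ[k] k) : Prop :=
  ∀ S (r : Fin (a + 1)), (∀ g ∈ S, g.2 ≠ r) → Φ (lp k b S) = 0

section
variable {b : Module.Basis (Pt a) k V} {t₁ t₂ : ℤ} {Φ ψ : ExteriorAlgebra k V →ₗ[k] k}

lemma IsCochain.isCocycle (h : IsCochain b t₁ t₂ ψ) :
    IsCocycle b t₁ t₂ (ψ ∘ₗ ctr (aug b)) where
  closed x := by rw [LinearMap.comp_apply, ctr_ctr, map_zero]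
  supp S hne := by
    by_contra hcon
    apply hne
    refine map_ctr_lp_eq_zero _ _ _ _ fun A g B hS => Or.inr ?_
    by_contra h0
    have h1 := h _ h0
    have h2 := g.1.2
    have h3 := g.2.2
    subst hS
    simp at h1 hcon
    omega

lemma IsCochain.rowClosed (h : IsCochain b t₁ t₂ ψ) : RowClosed b t₂ (ψ ∘ₗ ctr (aug b)) := by
  intro r s S hS
  have e : (ψ ∘ₗ ctr (aug b)) (ctr (rowf b r s) (lp k b S)) =
      (ψ ∘ₗ ctr (rowf b r s)) (ctr (rowf b r s) (lp k b S)) := by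
    refine map_ctr_lp_congr _ _ _ _ _ _ fun A g B hAB => ?_
    by_cases hg : g.2 = r ∨ g.2 = s
    · congr 1
      refine map_ctr_lp_congr _ _ _ _ _ _ fun A' g' B' hAB' => ?_
      by_cases hg' : g'.2 = r ∨ g'.2 = s
      · simp [hg']
      · suffices h0 : ψ (lp k b (A' ++ B')) = 0 by simp [h0]
        by_contra h0
        have h1 := (h _ h0).2.2
        have h2 := congrArg sr hAB'
        rw [hAB] at hS
        simp at hS h1 h2
        rw [Fin.ext_iff, Fin.ext_iff] at hg hg'
        omega
    · simp [hg]
  rw [e, LinearMap.comp_apply, ctr_ctr, map_zero]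

lemma IsCocycle.sub {Ψ} (h : IsCocycle b t₁ t₂ Φ) (h' : IsCocycle b t₁ t₂ Ψ) :
    IsCocycle b t₁ t₂ (Φ - Ψ) where
  closed x := by rw [LinearMap.sub_apply, h.closed, h'.closed, sub_zero]
  supp S hne := by
    by_cases h0 : Φ (lp k b S) = 0
    · refine h'.supp S fun h1 => hne ?_
      rw [LinearMap.sub_apply, h0, h1, sub_zero]
    · exact h.supp S h0

lemma RowClosed.sub {Ψ} (h : RowClosed b t₂ Φ) (h' : RowClosed b t₂ Ψ) :
    RowClosed b t₂ (Φ - Ψ) := fun r s S hS => by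
  rw [LinearMap.sub_apply, h r s S hS, h' r s S hS, sub_zero]

/-- Filling an empty row gives a value independent of all choices. -/
lemma RowClosed.fill_eq (h : RowClosed b t₂ Φ) (G) (hG : sr G = t₂) (g g' : Pt a)
    (hg : ∀ x ∈ G, x.2 ≠ g.2) (hg' : ∀ x ∈ G, x.2 ≠ g'.2) :
    Φ (lp k b (g :: G)) = Φ (lp k b (g' :: G)) := by
  have e := h g.2 g'.2 (g' :: g :: G) (by simp; omega)
  rw [ctr_lp_cons, ctr_lp_cons, ctr_lp_eq_zero (rowf b g.2 g'.2) b G (fun x hx => by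
    rw [rowf_apply, if_neg (by simp [hg x hx, hg' x hx])])] at e
  simp only [rowf_apply, true_or, or_true, if_true, one_smul, mul_zero, sub_zero, map_sub,
    sub_eq_zero, ← lp_cons] at e
  exact e

lemma exists_fill (h : IsCocycle b t₁ t₂ Φ) (hZ : RowClosed b t₂ Φ) :
    ∃ ψ, IsCochain b t₁ t₂ ψ ∧ ∀ G (g : Pt a), G.length = a + 1 → sr G = t₂ →
      (∀ x ∈ G, x.2 ≠ g.2) → ψ (lp k b G) = Φ (lp k b (g :: G)) := by
  classical
  let q : Finset (Pt a) → Prop := fun F => F.card = a + 1 ∧ ∑ x ∈ F, ((x.2 : ℕ) : ℤ) = t₂ ∧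
    ∃ r, ∀ x ∈ F, x.2 ≠ r
  obtain ⟨ψ, hψ⟩ := exists_piecewise b (fun F => if hF : q F then
    Φ ∘ₗ LinearMap.mulLeft k (ExteriorAlgebra.ι k (b (0, hF.2.2.choose))) else 0)
  have hq : ∀ G : List (Pt a), G.Nodup → ∀ r, (∀ x ∈ G, x.2 ≠ r) → G.length = a + 1 → sr G = t₂ →
      q G.toFinset := by
    intro G hnd r hr h1 h2
    refine ⟨by rw [List.toFinset_card_of_nodup hnd, h1], ?_, r, by simpa using hr⟩
    rw [List.sum_toFinset _ hnd]
    exact h2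
  have key : ∀ G (g : Pt a), G.length = a + 1 → sr G = t₂ →
      (∀ x ∈ G, x.2 ≠ g.2) → ψ (lp k b G) = Φ (lp k b (g :: G)) := by
    intro G g h1 h2 h3
    by_cases hnd : G.Nodup
    · have hF := hq G hnd g.2 h3 h1 h2
      rw [hψ G hnd, dif_pos hF]
      have e := hF.2.2.choose_spec
      exact hZ.fill_eq G h2 (0, _) g (fun x hx => e x (by simpa using hx)) h3
    · rw [lp_cons, lp_eq_zero_of_not_nodup _ hnd, mul_zero, map_zero, map_zero]
  refine ⟨ψ, fun G hne => ?_, key⟩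
  have hnd : G.Nodup := by
    by_contra hnd
    exact hne (by rw [lp_eq_zero_of_not_nodup _ hnd, map_zero])
  have hqG : q G.toFinset := by
    by_contra hqG
    exact hne (by rw [hψ G hnd, dif_neg hqG, LinearMap.zero_apply])
  obtain ⟨h1, h2, r, hr⟩ := hqG
  rw [List.toFinset_card_of_nodup hnd] at h1
  rw [List.sum_toFinset _ hnd] at h2
  change sr G = t₂ at h2
  have hr' : ∀ x ∈ G, x.2 ≠ r := by simpa using hr
  have s0 := h.supp _ (by rwa [key G (0, r) h1 h2 hr'] at hne)
  have s1 := h.supp _ (by rwa [key G (Fin.last a, r) h1 h2 hr'] at hne)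
  simp at s0 s1
  exact ⟨h1, by omega, h2⟩

/-- Up to a coboundary, a cocycle vanishes on products of basis vectors that avoid some row. -/
lemma exists_rowFull (h : IsCocycle b t₁ t₂ Φ) (hZ : RowClosed b t₂ Φ) :
    ∃ ψ, IsCochain b t₁ t₂ ψ ∧ RowFull b (Φ - ψ ∘ₗ ctr (aug b)) := by
  obtain ⟨ψ, hψ, hfill⟩ := exists_fill h hZ
  refine ⟨ψ, hψ, fun S r hr => ?_⟩
  have h' := h.sub hψ.isCocycle
  have hZ' := hZ.sub hψ.rowClosed
  have key : ∀ G, G.length = a + 1 → sr G = t₂ → (∀ x ∈ G, x.2 ≠ r) →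
      (Φ - ψ ∘ₗ ctr (aug b)) (lp k b ((0, r) :: G)) = 0 := by
    intro G h1 h2 h3
    rw [LinearMap.sub_apply, ← hfill G (0, r) h1 h2 h3, LinearMap.comp_apply, ctr_lp_cons,
      aug_apply, one_smul, map_sub, sub_sub_cancel]
    refine map_ctr_lp_eq_zero (aug b) b G (ψ ∘ₗ LinearMap.mulLeft k _) fun A g B hAB => Or.inr ?_
    by_contra hne
    rw [LinearMap.comp_apply, LinearMap.mulLeft_apply, ← lp_cons] at hne
    have h4 := (hψ _ hne).2.2
    have h5 := h3 g (by rw [hAB]; simp)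
    rw [hAB] at h2
    simp at h4 h2
    exact h5 (Fin.ext (by omega))
  by_contra hne
  obtain ⟨hl, -, -, hs1, hs2⟩ := h'.supp _ hne
  let q : Fin (a + 1) := ⟨(sr S - t₂).toNat, by omega⟩
  have hq : ((q : ℕ) : ℤ) = sr S - t₂ := Int.toNat_of_nonneg (by omega)
  have e := hZ' q r ((0, r) :: S) (by simp; omega)
  rw [ctr_lp_cons, rowf_apply, if_pos (Or.inr rfl), one_smul, map_sub, sub_eq_zero] at e
  apply hne
  rw [e]
  refine map_ctr_lp_eq_zero _ b S ((Φ - ψ ∘ₗ ctr (aug b)) ∘ₗ LinearMap.mulLeft k _)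
    fun A g B hAB => ?_
  by_cases hg : g.2 = q
  · right
    rw [LinearMap.comp_apply, LinearMap.mulLeft_apply, ← lp_cons]
    have hgq : ((g.2 : ℕ) : ℤ) = sr S - t₂ := by rw [hg, hq]
    subst hAB
    apply key
    · simp at hl ⊢
      omega
    · simp at hgq ⊢
      omega
    · intro x hx
      apply hr
      simp at hx ⊢
      tauto
  · left
    rw [rowf_apply, if_neg]
    rintro (h1 | h1)
    · exact hg h1
    · exact hr g (by rw [hAB]; simp) h1

end
end SegreCross

namespace SegreCross

variable {k V : Type*} [Field k] [AddCommGroup V] [Module k V] {a : ℕ}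

/-- One point in each row. -/
def rowGraph (f : Fin (a + 1) → Fin (a + 1)) : List (Pt a) :=
  (List.finRange (a + 1)).map fun s => (f s, s)

lemma length_rowGraph (f : Fin (a + 1) → Fin (a + 1)) : (rowGraph f).length = a + 1 := by
  simp [rowGraph]

lemma mem_rowGraph {f : Fin (a + 1) → Fin (a + 1)} {g : Pt a} : g ∈ rowGraph f ↔ f g.2 = g.1 := by
  simp only [rowGraph, List.mem_map, List.mem_finRange, true_and]
  constructor
  · rintro ⟨s, rfl⟩
    rfl
  · intro h
    exact ⟨g.2, Prod.ext h rfl⟩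

lemma nodup_rowGraph (f : Fin (a + 1) → Fin (a + 1)) : (rowGraph f).Nodup := by
  refine (List.nodup_finRange _).map fun x y hxy => ?_
  exact (Prod.ext_iff.1 hxy).2

lemma sc_rowGraph (f : Fin (a + 1) → Fin (a + 1)) : sc (rowGraph f) = ∑ s, ((f s : ℕ) : ℤ) := by
  rw [sc, rowGraph, List.map_map, ← List.sum_ofFn, List.ofFn_eq_map]
  rfl

lemma two_mul_sr_rowGraph (f : Fin (a + 1) → Fin (a + 1)) :
    2 * sr (rowGraph f) = a * (a + 1) := by
  have h := two_mul_sum_fin (a + 1)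
  have : sr (rowGraph f) = ∑ i : Fin (a + 1), ((i : ℕ) : ℤ) := by
    rw [sr, rowGraph, List.map_map, ← List.sum_ofFn, List.ofFn_eq_map]
    rfl
  rw [this, h]
  push_cast
  ring

lemma rowGraph_update (f : Fin (a + 1) → Fin (a + 1)) (s : Fin (a + 1)) :
    ∃ A B : List (Pt a), (∀ g ∈ A, g.2 ≠ s) ∧ (∀ g ∈ B, g.2 ≠ s) ∧
      ∀ j, rowGraph (Function.update f s j) = A ++ (j, s) :: B := by
  obtain ⟨A, B, hAB⟩ := List.append_of_mem (List.mem_finRange s)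
  have hnd := List.nodup_finRange (a + 1)
  rw [hAB] at hnd
  have hA : ∀ x ∈ A, x ≠ s := fun x hx => (List.nodup_append.1 hnd).2.2 x hx s (by simp)
  have hB : ∀ x ∈ B, x ≠ s := by
    rintro x hx rfl
    exact (List.nodup_cons.1 (List.nodup_append.1 hnd).2.1).1 hx
  refine ⟨A.map fun s => (f s, s), B.map fun s => (f s, s), ?_, ?_, ?_⟩
  · simpa using hA
  · simpa using hB
  · intro j
    rw [rowGraph, hAB, List.map_append, List.map_cons, Function.update_self]
    congr 1
    · refine List.map_congr_left fun x hx => ?_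
      rw [Function.update_of_ne (hA x hx)]
    · congr 1
      refine List.map_congr_left fun x hx => ?_
      rw [Function.update_of_ne (hB x hx)]

lemma ι_mul_ctr_rowGraph (b : Module.Basis (Pt a) k V) (f : Fin (a + 1) → Fin (a + 1)) (r i) :
    ExteriorAlgebra.ι k (b (i, r)) * ctr (rowf b r r) (lp k b (rowGraph f)) =
      lp k b (rowGraph (Function.update f r i)) := by
  obtain ⟨A, B, hA, hB, h⟩ := rowGraph_update f r
  have h0 := h (f r)
  rw [Function.update_eq_self] at h0
  have z : ∀ L : List (Pt a), (∀ g ∈ L, g.2 ≠ r) → ctr (rowf b r r) (lp k b L) = 0 :=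
    fun L hL => ctr_lp_eq_zero _ _ _ fun g hg => by
      rw [rowf_apply, if_neg (by simpa using hL g hg)]
  rw [h, h0, lp_append, ctr_lp_mul, z A hA, ctr_lp_cons, z B hB, lp_middle]
  simp only [zero_mul, zero_add, rowf_apply, true_or, if_true, one_smul, mul_zero, sub_zero,
    lp_cons, lp_append, mul_smul_comm]

lemma perm_cons_rowGraph {S : List (Pt a)} (hlen : S.length = a + 2)
    (hS : ∀ r, ∃ g ∈ S, g.2 = r) : ∃ f g, S.Perm (g :: rowGraph f) := by
  choose x hx hxr using hS
  let f : Fin (a + 1) → Fin (a + 1) := fun r => (x r).1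
  have hsub : (rowGraph f).Subperm S := by
    refine (nodup_rowGraph f).subperm fun g hg => ?_
    rw [mem_rowGraph] at hg
    have : g = x g.2 := Prod.ext hg.symm (hxr _).symm
    rw [this]
    exact hx _
  have hp := List.subperm_append_diff_self_of_count_le (List.subperm_ext_iff.1 hsub)
  have hl : (S.diff (rowGraph f)).length = 1 := by
    have := hp.length_eq
    rw [List.length_append, length_rowGraph, hlen] at this
    omega
  obtain ⟨g, hg⟩ := List.length_eq_one_iff.1 hl
  rw [hg] at hp
  exact ⟨f, g, hp.symm.trans (List.perm_append_singleton _ _)⟩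

lemma map_ctr_cons_rowGraph {b : Module.Basis (Pt a) k V} (f : Fin (a + 1) → Fin (a + 1)) (r i)
    (ψ : ExteriorAlgebra k V →ₗ[k] k) (hψ : ∀ A g B, (i, r) :: rowGraph f = A ++ g :: B →
      g.2 ≠ r → ψ (lp k b (A ++ B)) = 0) :
    ψ (ctr (aug b) (lp k b ((i, r) :: rowGraph f))) =
      ψ (lp k b (rowGraph f)) - ψ (lp k b (rowGraph (Function.update f r i))) := by
  have e : ψ (ctr (aug b) (lp k b ((i, r) :: rowGraph f))) =
      ψ (ctr (rowf b r r) (lp k b ((i, r) :: rowGraph f))) := by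
    refine map_ctr_lp_congr _ _ _ _ _ _ fun A g B hAB => ?_
    by_cases hg : g.2 = r
    · simp [hg]
    · rw [hψ A g B hAB hg, smul_zero, smul_zero]
  rw [e, ctr_lp_cons, rowf_apply, if_pos (Or.inl rfl), one_smul, ι_mul_ctr_rowGraph, map_sub]

section Generic

variable {ι α : Type*} [DecidableEq ι]

lemma eq_of_update [Fintype ι] {β : Type*} (X : (ι → α) → β) (P : ι → Prop)
    (h : ∀ f s j, P s → X (Function.update f s j) = X f) (f f' : ι → α)
    (hf : ∀ s, ¬ P s → f s = f' s) : X f = X f' := by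
  have key : ∀ T : Finset ι, X (T.piecewise f' f) = X f := by
    intro T
    induction T using Finset.induction_on with
    | empty => simp
    | insert s T _ ih =>
      rw [Finset.piecewise_insert, ← ih]
      by_cases hs : P s
      · exact h _ _ _ hs
      · by_cases hT : s ∈ T
        · rw [← Finset.piecewise_eq_of_mem T f' f hT, Function.update_eq_self]
        · rw [← hf s hs, ← Finset.piecewise_eq_of_notMem T f' f hT, Function.update_eq_self]
  rw [← key Finset.univ, Finset.piecewise_univ]

/-- A closed system of differences has a potential. -/
lemma exists_potential [Fintype ι] [Nonempty α] (D : (ι → α) → ι → α → k)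
    (tri : ∀ f r i j, D f r i + D (Function.update f r i) r j = D f r j)
    (sq : ∀ f r s i j, r ≠ s → D f r i + D (Function.update f r i) s j =
      D f s j + D (Function.update f s j) r i) :
    ∃ h : (ι → α) → k, ∀ f r i, D f r i = h f - h (Function.update f r i) := by
  have key : ∀ T : Finset ι, ∃ h : (ι → α) → k, ∀ f, ∀ r ∈ T, ∀ i,
      D f r i = h f - h (Function.update f r i) := by
    intro T
    induction T using Finset.induction_on with
    | empty => exact ⟨0, by simp⟩
    | insert s T hs ih =>
      obtain ⟨h, hh⟩ := ih
      obtain ⟨c⟩ := ‹Nonempty α›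
      refine ⟨fun f => h (Function.update f s c) + D f s c, fun f r hr i => ?_⟩
      by_cases hrs : r = s
      · subst hrs
        beta_reduce
        rw [Function.update_idem]
        linear_combination tri f r i c
      · have e := hh (Function.update f s c) r (Finset.mem_of_mem_insert_of_ne hr hrs) i
        rw [Function.update_comm (Ne.symm hrs)] at e
        linear_combination e + sq f r s i c hrs
  obtain ⟨h, hh⟩ := key Finset.univ
  exact ⟨h, fun f r i => hh f r (Finset.mem_univ _) i⟩

end Generic

section
variable {b : Module.Basis (Pt a) k V} {t₁ t₂ : ℤ} {Φ ψ : ExteriorAlgebra k V →ₗ[k] k}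

lemma map_ctr_row_cons_cons_rowGraph (Φ : ExteriorAlgebra k V →ₗ[k] k)
    (f : Fin (a + 1) → Fin (a + 1)) (r s i j)
    (hrs : r ≠ s) : Φ (ctr (rowf b s s) (lp k b ((j, s) :: (i, r) :: rowGraph f))) =
      Φ (lp k b ((i, r) :: rowGraph f)) -
        Φ (lp k b ((i, r) :: rowGraph (Function.update f s j))) := by
  rw [ctr_lp_cons, ctr_lp_cons, rowf_apply, rowf_apply, if_pos (Or.inl rfl),
    if_neg (by simpa using hrs), one_smul, zero_smul, zero_sub, mul_neg, sub_neg_eq_add,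
    ← mul_assoc, ι_mul_ι_comm, neg_mul, mul_assoc, ι_mul_ctr_rowGraph, map_add, map_neg,
    ← sub_eq_add_neg, ← lp_cons b (i, r)]

lemma RowFull.apply_append {f : Fin (a + 1) → Fin (a + 1)} {S : List (Pt a)} (hE : RowFull b Φ)
    {A g B} (hS : S ++ rowGraph f = A ++ g :: B) (hg : ∀ x ∈ S, x.2 ≠ g.2) :
    Φ (lp k b (A ++ B)) = 0 := by
  by_cases hnd : (A ++ B).Nodup
  swap
  · rw [lp_eq_zero_of_not_nodup _ hnd, map_zero]
  refine hE _ g.2 fun x hx hxg => ?_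
  have hp : (S ++ rowGraph f).Perm (g :: (A ++ B)) := by
    rw [hS]
    exact List.perm_middle
  have mem : ∀ y ∈ g :: (A ++ B), y.2 = g.2 → y ∈ rowGraph f := by
    intro y hy hyg
    rcases List.mem_append.1 (hp.mem_iff.2 hy) with h | h
    · exact absurd hyg (hg y h)
    · exact h
  have hgm := mem_rowGraph.1 (mem g (by simp) rfl)
  have hxm := mem_rowGraph.1 (mem x (by simp [List.mem_append.1 hx]) hxg)
  have hxeq : x = g := Prod.ext (by rw [← hxm, ← hgm, hxg]) hxg
  subst hxeq
  have c1 : (rowGraph f).count x ≤ 1 := List.nodup_iff_count_le_one.1 (nodup_rowGraph f) x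
  have c2 : S.count x = 0 := List.count_eq_zero.2 fun h => hg x h rfl
  have c3 := hp.count_eq x
  have c4 : 0 < (A ++ B).count x := List.count_pos_iff.2 hx
  rw [List.count_append, List.count_cons_self] at c3
  omega

/-- Off the central row weight, there is nothing left. -/
lemma IsCocycle.eq_zero_of_rowFull (h : IsCocycle b t₁ t₂ Φ) (ha : 2 ≤ a) (hZ : RowClosed b t₂ Φ)
    (hE : RowFull b Φ) (ht : 2 * t₂ ≠ a * (a + 1)) : Φ = 0 := by
  refine ext_lp_grid b fun S => ?_
  rw [LinearMap.zero_apply]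
  by_contra hne
  obtain ⟨hlen, -⟩ := h.supp S hne
  obtain ⟨f, ⟨i, r⟩, hp⟩ := perm_cons_rowGraph hlen (by
    by_contra hcon
    push Not at hcon
    obtain ⟨r, hr⟩ := hcon
    exact hne (hE S r hr))
  obtain ⟨c, -, hc⟩ := lp_perm (k := k) b hp
  have hne' : Φ (lp k b ((i, r) :: rowGraph f)) ≠ 0 := fun h0 => by
    rw [hc, map_smul, h0, smul_zero] at hne
    exact hne rfl
  obtain ⟨-, -, -, hs1, hs2⟩ := h.supp _ hne'
  let q : Fin (a + 1) := ⟨(sr ((i, r) :: rowGraph f) - t₂).toNat, by omega⟩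
  have hq : ((q : ℕ) : ℤ) = sr ((i, r) :: rowGraph f) - t₂ := Int.toNat_of_nonneg (by omega)
  have srf := two_mul_sr_rowGraph (a := a)
  have hqr : q ≠ r := by
    intro hqr
    rw [sr_cons, hqr] at hq
    have := srf f
    apply ht
    dsimp only at hq
    linarith
  have inv : ∀ f' s j, s ≠ r →
      Φ (lp k b ((i, r) :: rowGraph (Function.update f' s j))) =
      Φ (lp k b ((i, r) :: rowGraph f')) := by
    intro f' s j hsr
    have e := hZ q s ((j, s) :: (i, r) :: rowGraph f') (by
      have := srf f
      have := srf f'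
      simp at hq ⊢
      omega)
    have e' : Φ (ctr (rowf b q s) (lp k b ((j, s) :: (i, r) :: rowGraph f'))) =
        Φ (ctr (rowf b s s) (lp k b ((j, s) :: (i, r) :: rowGraph f'))) := by
      refine map_ctr_lp_congr _ _ _ _ _ _ fun A g B hAB => ?_
      by_cases hg : g.2 = q ∧ q ≠ s
      · rw [hE.apply_append (S := [(j, s), (i, r)]) hAB, smul_zero, smul_zero]
        simp [hg.1, hqr.symm, hg.2.symm]
      · congr 1
        rw [rowf_apply, rowf_apply]
        refine if_congr ?_ rfl rfl
        constructor
        · rintro (h1 | h1)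
          · left
            by_contra h2
            exact hg ⟨h1, fun h3 => h2 (h1.trans h3)⟩
          · simp [h1]
        · rintro (h1 | h1) <;> simp [h1]
    rw [e', map_ctr_row_cons_cons_rowGraph _ _ _ _ _ _ hsr.symm, sub_eq_zero] at e
    exact e.symm
  have val : ∀ c : Fin (a + 1), t₁ ≤ (i : ℕ) + (f r : ℕ) + a * (c : ℕ) ∧
      (i : ℕ) + (f r : ℕ) + a * (c : ℕ) ≤ t₁ + a := by
    intro c
    have e := eq_of_update (fun f => Φ (lp k b ((i, r) :: rowGraph f))) (· ≠ r) inv f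
      (Function.update (fun _ => c) r (f r)) (by
        intro s hs
        rw [not_not.1 hs, Function.update_self])
    have s := h.supp _ (e ▸ hne')
    have hsum : sc (rowGraph (Function.update (fun _ => c) r (f r))) = (f r : ℕ) + a * (c : ℕ) := by
      rw [sc_rowGraph, ← Finset.add_sum_erase _ _ (Finset.mem_univ r), Function.update_self,
        Finset.sum_congr rfl (g := fun _ => ((c : ℕ) : ℤ))]
      · simp
      · intro x hx
        rw [Function.update_of_ne (Finset.ne_of_mem_erase hx)]
    rw [sc_cons, hsum] at s
    constructor <;> linarith [s.2.1, s.2.2.1]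
  have v0 := (val 0).1
  have v1 := (val (Fin.last a)).2
  simp at v0 v1
  have : (2 : ℤ) ≤ a := by exact_mod_cast ha
  nlinarith

lemma IsCocycle.exists_potential (h : IsCocycle b t₁ t₂ Φ) (hE : RowFull b Φ) :
    ∃ p : (Fin (a + 1) → Fin (a + 1)) → k, ∀ f r i,
      Φ (lp k b ((i, r) :: rowGraph f)) = p f - p (Function.update f r i) := by
  refine SegreCross.exists_potential (fun f r i => Φ (lp k b ((i, r) :: rowGraph f))) ?_ ?_
  · intro f r i j
    have e := h.closed (lp k b ((j, r) :: (i, r) :: rowGraph f))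
    have e' : Φ (ctr (aug b) (lp k b ((j, r) :: (i, r) :: rowGraph f))) =
        Φ (ctr (rowf b r r) (lp k b ((j, r) :: (i, r) :: rowGraph f))) := by
      refine map_ctr_lp_congr _ _ _ _ _ _ fun A g B hAB => ?_
      by_cases hg : g.2 = r
      · simp [hg]
      · rw [hE.apply_append (S := [(j, r), (i, r)]) hAB, smul_zero, smul_zero]
        simp [Ne.symm hg]
    rw [e', ctr_lp_cons, ctr_lp_cons, ι_mul_ctr_rowGraph, rowf_apply, rowf_apply,
      if_pos (Or.inl rfl), one_smul, one_smul, mul_sub, map_sub, map_sub,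
      ← lp_cons, ← lp_cons] at e
    linear_combination e
  · intro f r s i j hrs
    have e := h.closed (lp k b ((j, s) :: (i, r) :: rowGraph f))
    have e' : Φ (ctr (aug b) (lp k b ((j, s) :: (i, r) :: rowGraph f))) =
        Φ (ctr (rowf b r r + rowf b s s) (lp k b ((j, s) :: (i, r) :: rowGraph f))) := by
      refine map_ctr_lp_congr _ _ _ _ _ _ fun A g B hAB => ?_
      by_cases hg : g.2 = r
      · simp [hg, hrs]
      by_cases hg' : g.2 = s
      · simp [hg', hrs.symm]
      · rw [hE.apply_append (S := [(j, s), (i, r)]) hAB, smul_zero, smul_zero]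
        simp [Ne.symm hg, Ne.symm hg']
    have e2 : ctr (rowf b r r + rowf b s s) (lp k b ((j, s) :: (i, r) :: rowGraph f)) =
        ctr (rowf b r r) (lp k b ((j, s) :: (i, r) :: rowGraph f)) +
        ctr (rowf b s s) (lp k b ((j, s) :: (i, r) :: rowGraph f)) := by
      simp [ctr]
    have e3 := map_ctr_row_cons_cons_rowGraph (b := b) Φ f s r j i hrs.symm
    have e4 := map_ctr_row_cons_cons_rowGraph (b := b) Φ f r s i j hrs
    rw [lp_swap, map_neg, map_neg] at e3
    rw [e', e2, map_add, e4] at e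
    linear_combination e + e3

end
end SegreCross

namespace SegreCross

variable {k V : Type*} [Field k] [AddCommGroup V] [Module k V] {a : ℕ}

section Det

/-- The determinant as a functional on the exterior algebra of a coordinate space. -/
def topDet (k : Type*) [Field k] (a : ℕ) : ExteriorAlgebra k (Fin (a + 1) → k) →ₗ[k] k :=
  ExteriorAlgebra.liftAlternating (Pi.single (a + 1) Matrix.detRowAlternating)

lemma lp_eq_ιMulti {I : Type*} (e : I → V) (n : ℕ) (v : Fin n → I) :
    lp k e (List.ofFn v) = ExteriorAlgebra.ιMulti k n (e ∘ v) := by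
  rw [ExteriorAlgebra.ιMulti_apply, lp, List.map_ofFn]
  rfl

lemma topDet_lp_ofFn {I : Type*} (e : I → Fin (a + 1) → k) (v : Fin (a + 1) → I) :
    topDet k a (lp k e (List.ofFn v)) = Matrix.det (Matrix.of fun i => e (v i)) := by
  rw [lp_eq_ιMulti, topDet, ExteriorAlgebra.liftAlternating_apply_ιMulti, Pi.single_eq_same]
  rfl

lemma topDet_lp_of_length_ne {I : Type*} (e : I → Fin (a + 1) → k) (S : List I)
    (hS : S.length ≠ a + 1) : topDet k a (lp k e S) = 0 := by
  rw [← List.ofFn_get S, lp_eq_ιMulti, topDet, ExteriorAlgebra.liftAlternating_apply_ιMulti,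
    Pi.single_eq_of_ne hS, AlternatingMap.zero_apply]

lemma map_lp {W I : Type*} [AddCommGroup W] [Module k W] (f : V →ₗ[k] W) (e : I → V) (S : List I) :
    ExteriorAlgebra.map f (lp k e S) = lp k (f ∘ e) S := by
  induction S with
  | nil => simp
  | cons g S ih => rw [lp_cons, map_mul, ih, ExteriorAlgebra.map_apply_ι, lp_cons]; rfl

lemma map_ctr_lp {W I : Type*} [AddCommGroup W] [Module k W] (f : V →ₗ[k] W)
    (d : Module.Dual k W) (e : I → V) (S : List I) :
    ExteriorAlgebra.map f (ctr (d ∘ₗ f) (lp k e S)) = ctr d (lp k (f ∘ e) S) := by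
  induction S with
  | nil => simp [ctr_one]
  | cons g S ih =>
    rw [ctr_lp_cons, ctr_lp_cons, map_sub, map_mul, ih, map_smul, map_lp,
      ExteriorAlgebra.map_apply_ι]
    rfl

/-- Projection of the grid onto one of its coordinates. -/
def coordProj (b : Module.Basis (Pt a) k V) (β : Pt a → Fin (a + 1)) : V →ₗ[k] Fin (a + 1) → k :=
  b.constr k fun g => Pi.single (β g) 1

lemma coordProj_apply (b : Module.Basis (Pt a) k V) (β : Pt a → Fin (a + 1)) (g : Pt a) :
    coordProj b β (b g) = Pi.single (β g) 1 := by rw [coordProj, Module.Basis.constr_basis]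

/-- The determinant of the projection to one of the coordinates of the grid. -/
def detFun (b : Module.Basis (Pt a) k V) (β : Pt a → Fin (a + 1)) : ExteriorAlgebra k V →ₗ[k] k :=
  topDet k a ∘ₗ (ExteriorAlgebra.map (coordProj b β)).toLinearMap

variable (b : Module.Basis (Pt a) k V) (β : Pt a → Fin (a + 1))

lemma coordProj_lp (S : List (Pt a)) : lp k (coordProj b β ∘ b) S =
    lp k (fun s => (Pi.single s 1 : Fin (a + 1) → k)) (S.map β) := by
  rw [lp, lp, List.map_map]
  congr 1
  refine List.map_congr_left fun g _ => ?_
  simp [coordProj_apply]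

lemma detFun_lp (S : List (Pt a)) : detFun b β (lp k b S) =
    topDet k a (lp k (fun s => (Pi.single s 1 : Fin (a + 1) → k)) (S.map β)) := by
  rw [detFun, LinearMap.comp_apply, AlgHom.toLinearMap_apply, map_lp, coordProj_lp]

lemma detFun_lp_eq_one (S : List (Pt a)) (hS : S.map β = List.finRange (a + 1)) :
    detFun b β (lp k b S) = 1 := by
  rw [detFun_lp, hS, List.finRange, topDet_lp_ofFn]
  convert Matrix.det_one (n := Fin (a + 1)) (R := k) using 2
  ext i j
  simp [Matrix.one_apply, Pi.single_apply, eq_comm]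

lemma perm_of_detFun_ne_zero (S : List (Pt a)) (hS : detFun b β (lp k b S) ≠ 0) :
    (S.map β).Perm (List.finRange (a + 1)) := by
  rw [detFun_lp] at hS
  have hnd : (S.map β).Nodup := by
    by_contra hnd
    exact hS (by rw [lp_eq_zero_of_not_nodup _ hnd, map_zero])
  have hlen : (S.map β).length = a + 1 := by
    by_contra hl
    exact hS (topDet_lp_of_length_ne _ _ hl)
  refine (hnd.subperm fun x _ => List.mem_finRange x).perm_of_length_le ?_
  rw [hlen, List.length_finRange]

lemma two_mul_sum_of_detFun_ne_zero (S : List (Pt a)) (hS : detFun b β (lp k b S) ≠ 0) :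
    2 * (S.map fun g => ((β g : ℕ) : ℤ)).sum = a * (a + 1) := by
  have h := (perm_of_detFun_ne_zero b β S hS).map fun s : Fin (a + 1) => ((s : ℕ) : ℤ)
  rw [List.map_map] at h
  have e := h.sum_eq
  change (S.map fun g => ((β g : ℕ) : ℤ)).sum = _ at e
  rw [e, ← List.ofFn_eq_map, List.sum_ofFn, two_mul_sum_fin]
  push_cast
  ring

lemma length_of_detFun_ne_zero (S : List (Pt a)) (hS : detFun b β (lp k b S) ≠ 0) :
    S.length = a + 1 := by
  simpa using (perm_of_detFun_ne_zero b β S hS).length_eq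

lemma detFun_ctr_aug (S : List (Pt a)) : detFun b β (ctr (aug b) (lp k b S)) = 0 := by
  by_cases hS : S.length = a + 2
  · have e : aug b = (∑ s, LinearMap.proj s) ∘ₗ coordProj b β := by
      refine b.ext fun g => ?_
      simp [coordProj_apply]
    rw [e, detFun, LinearMap.comp_apply, AlgHom.toLinearMap_apply, map_ctr_lp, coordProj_lp,
      lp_eq_zero_of_not_nodup, map_zero, map_zero]
    intro hnd
    have := hnd.length_le_card
    simp [hS] at this
  · refine map_ctr_lp_eq_zero _ _ _ _ fun A g B hAB => Or.inr ?_
    by_contra hne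
    have := length_of_detFun_ne_zero b β _ hne
    rw [hAB] at hS
    simp at this hS
    omega

/-- A determinant restricted to one side of a hyperplane, and the weights of its coboundary. -/
lemma exists_class (α : Pt a → Fin (a + 1)) (t : ℤ) :
    ∃ ψ : ExteriorAlgebra k V →ₗ[k] k,
      (∀ S : List (Pt a), ψ (lp k b S) =
        if t < (S.map fun g => ((α g : ℕ) : ℤ)).sum then detFun b β (lp k b S) else 0) ∧
      ∀ S : List (Pt a), ψ (ctr (aug b) (lp k b S)) ≠ 0 → S.length = a + 2 ∧
        t ≤ (S.map fun g => ((α g : ℕ) : ℤ)).sum ∧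
        (S.map fun g => ((α g : ℕ) : ℤ)).sum ≤ t + a ∧
        ∃ s : Fin (a + 1), 2 * ((S.map fun g => ((β g : ℕ) : ℤ)).sum - (s : ℕ)) = a * (a + 1) := by
  classical
  obtain ⟨ψ, hψ⟩ := exists_piecewise b
    (fun F => if t < ∑ x ∈ F, ((α x : ℕ) : ℤ) then detFun b β else 0)
  have val : ∀ S : List (Pt a), ψ (lp k b S) =
      if t < (S.map fun g => ((α g : ℕ) : ℤ)).sum then detFun b β (lp k b S) else 0 := by
    intro S
    by_cases hnd : S.Nodup
    · rw [hψ S hnd, List.sum_toFinset _ hnd]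
      split_ifs <;> rfl
    · rw [lp_eq_zero_of_not_nodup _ hnd]
      simp
  refine ⟨ψ, val, fun S hne => ?_⟩
  obtain ⟨A, g, B, hAB, hne1⟩ : ∃ A g B, S = A ++ g :: B ∧ ψ (lp k b (A ++ B)) ≠ 0 := by
    by_contra hcon
    push Not at hcon
    exact hne (map_ctr_lp_eq_zero _ _ _ _ fun A g B hAB => Or.inr (hcon A g B hAB))
  rw [val] at hne1
  have hgt : t < ((A ++ B).map fun g => ((α g : ℕ) : ℤ)).sum := by
    by_contra h0
    exact hne1 (if_neg h0)
  rw [if_pos hgt] at hne1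
  refine ⟨?_, ?_, ?_, β g, ?_⟩
  · have := length_of_detFun_ne_zero b β _ hne1
    rw [hAB]
    simp at this ⊢
    omega
  · rw [hAB]
    simp at hgt ⊢
    omega
  · by_contra hcon
    apply hne
    rw [← detFun_ctr_aug b β S]
    refine map_ctr_lp_congr _ _ _ _ _ _ fun A g B hAB => ?_
    congr 1
    rw [val, if_pos]
    have := (α g).2
    rw [hAB] at hcon
    simp at hcon ⊢
    omega
  · have := two_mul_sum_of_detFun_ne_zero b β _ hne1
    rw [hAB]
    simp at this ⊢
    linarith

end Det

section Omega

/-- Staircase functions. -/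
def stair (a j : ℕ) : Fin (a + 1) → Fin (a + 1) := fun s => if (s : ℕ) < j then Fin.last a else 0

lemma update_stair (r : Fin (a + 1)) :
    Function.update (stair a r) r (Fin.last a) = stair a (r + 1) := by
  ext s
  by_cases h : s = r
  · subst h
    simp [stair]
  · rw [Function.update_of_ne h]
    have : (s : ℕ) ≠ r := fun h' => h (Fin.ext h')
    simp only [stair]
    congr 2
    simp only [eq_iff_iff]
    omega

lemma sum_stair_sub (F : (Fin (a + 1) → Fin (a + 1)) → k) :
    ∑ r : Fin (a + 1), (F (stair a r) - F (Function.update (stair a r) r (Fin.last a))) =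
      F (fun _ => 0) - F (fun _ => Fin.last a) := by
  simp_rw [update_stair]
  rw [Fin.sum_univ_eq_sum_range (fun r => F (stair a r) - F (stair a (r + 1))),
    Finset.sum_range_sub']
  congr 2
  ext s
  rw [stair, if_pos s.2]

/-- The test chain detecting the classes of central row weight. -/
def om (b : Module.Basis (Pt a) k V) : ExteriorAlgebra k V :=
  ∑ r : Fin (a + 1), lp k b ((Fin.last a, r) :: rowGraph (stair a r))

lemma map_ctr_om {b : Module.Basis (Pt a) k V} (ψ : ExteriorAlgebra k V →ₗ[k] k)
    (hψ : ∀ S, ψ (lp k b S) ≠ 0 → 2 * sr S = a * (a + 1)) :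
    ψ (ctr (aug b) (om b)) =
      ψ (lp k b (rowGraph fun _ => 0)) - ψ (lp k b (rowGraph fun _ => Fin.last a)) := by
  rw [om, map_sum, map_sum, ← sum_stair_sub fun f => ψ (lp k b (rowGraph f))]
  refine Finset.sum_congr rfl fun r _ => ?_
  rw [map_ctr_cons_rowGraph]
  intro A g B hAB hg
  by_contra hne
  have h1 := hψ _ hne
  have h2 := congrArg sr hAB
  have h3 := two_mul_sr_rowGraph (stair a r)
  simp at h1 h2
  exact hg (Fin.ext (by omega))

end Omega
end SegreCross

namespace SegreCross

variable {k V : Type*} [Field k] [AddCommGroup V] [Module k V] {a : ℕ}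

lemma eq_const_of_update {ι α β : Type*} [Fintype ι] [DecidableEq ι] (p : (ι → α) → β) (c : α)
    (P : (ι → α) → Prop) (hP : ∀ f r, P f → P (Function.update f r c))
    (h : ∀ f r, P f → p f = p (Function.update f r c)) (f : ι → α) (hf : P f) :
    p f = p fun _ => c := by
  have key : ∀ T : Finset ι,
      P (T.piecewise (fun _ => c) f) ∧ p (T.piecewise (fun _ => c) f) = p f := by
    intro T
    induction T using Finset.induction_on with
    | empty => simpa using hf
    | insert s T _ ih =>
      rw [Finset.piecewise_insert]
      exact ⟨hP _ _ ih.1, by rw [← h _ _ ih.1, ih.2]⟩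
  simpa using (key Finset.univ).2.symm

section
variable {b : Module.Basis (Pt a) k V} {t₁ t₂ : ℤ} {Φ ψ : ExteriorAlgebra k V →ₗ[k] k}

lemma IsCocycle.potential_eq_zero (h : IsCocycle b t₁ t₂ Φ)
    {p : (Fin (a + 1) → Fin (a + 1)) → k} (hp : ∀ f r i,
      Φ (lp k b ((i, r) :: rowGraph f)) = p f - p (Function.update f r i))
    (f : Fin (a + 1) → Fin (a + 1)) (hf : ∑ s, ((f s : ℕ) : ℤ) < t₁) : p f = p fun _ => 0 := by
  refine eq_const_of_update p 0 (fun f => ∑ s, ((f s : ℕ) : ℤ) < t₁) (fun f r hf => ?_)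
    (fun f r hf => ?_) f hf
  · refine lt_of_le_of_lt (Finset.sum_le_sum fun s _ => ?_) hf
    by_cases hs : s = r
    · subst hs
      simp
    · rw [Function.update_of_ne hs]
  · rw [← sub_eq_zero, ← hp]
    by_contra hne
    have := h.supp _ hne
    rw [← sc_rowGraph] at hf
    simp at this
    omega

lemma IsCocycle.potential_eq_last (h : IsCocycle b t₁ t₂ Φ)
    {p : (Fin (a + 1) → Fin (a + 1)) → k} (hp : ∀ f r i,
      Φ (lp k b ((i, r) :: rowGraph f)) = p f - p (Function.update f r i))
    (f : Fin (a + 1) → Fin (a + 1)) (hf : t₁ < ∑ s, ((f s : ℕ) : ℤ)) :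
    p f = p fun _ => Fin.last a := by
  refine eq_const_of_update p (Fin.last a) (fun f => t₁ < ∑ s, ((f s : ℕ) : ℤ)) (fun f r hf => ?_)
    (fun f r hf => ?_) f hf
  · refine lt_of_lt_of_le hf (Finset.sum_le_sum fun s _ => ?_)
    by_cases hs : s = r
    · subst hs
      have := (f s).2
      simp
      omega
    · rw [Function.update_of_ne hs]
  · rw [← sub_eq_zero, ← hp]
    by_contra hne
    have := h.supp _ hne
    rw [← sc_rowGraph] at hf
    simp at this
    omega

lemma map_snd_rowGraph (f : Fin (a + 1) → Fin (a + 1)) :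
    (rowGraph f).map Prod.snd = List.finRange (a + 1) := by
  rw [rowGraph, List.map_map]
  exact List.map_id _

lemma rowGraph_toFinset_injective :
    Function.Injective fun f : Fin (a + 1) → Fin (a + 1) => (rowGraph f).toFinset := by
  intro f f' hff
  ext s
  have : (f s, s) ∈ (rowGraph f').toFinset := by
    have e : (rowGraph f).toFinset = (rowGraph f').toFinset := hff
    rw [← e, List.mem_toFinset, mem_rowGraph]
  rw [List.mem_toFinset, mem_rowGraph] at this
  rw [this]

/-- A cochain with prescribed values on the graphs over the rows. -/
lemma exists_cochain_of_rowGraph (q : (Fin (a + 1) → Fin (a + 1)) → k) (ht : 2 * t₂ = a * (a + 1))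
    (hq : ∀ f, q f ≠ 0 → ∑ s, ((f s : ℕ) : ℤ) = t₁) :
    ∃ ψ, IsCochain b t₁ t₂ ψ ∧ RowFull b ψ ∧ ∀ f, ψ (lp k b (rowGraph f)) = q f := by
  obtain ⟨ψ, hψ⟩ := exists_piecewise b
    (fun F => (∑ f, if (rowGraph f).toFinset = F then q f else 0) • detFun b Prod.snd)
  refine ⟨ψ, fun G hne => ?_, fun S r hr => ?_, fun f => ?_⟩
  · have hnd : G.Nodup := by
      by_contra hnd
      exact hne (by rw [lp_eq_zero_of_not_nodup _ hnd, map_zero])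
    rw [hψ G hnd, LinearMap.smul_apply, smul_eq_mul] at hne
    obtain ⟨f, -, hf⟩ := Finset.exists_ne_zero_of_sum_ne_zero (left_ne_zero_of_mul hne)
    have hd := right_ne_zero_of_mul hne
    refine ⟨length_of_detFun_ne_zero _ _ _ hd, ?_, ?_⟩
    · have hF : (rowGraph f).toFinset = G.toFinset := by
        by_contra h0
        exact hf (if_neg h0)
      rw [if_pos hF] at hf
      rw [← hq f hf, ← sc_rowGraph, sc, sc, ← List.sum_toFinset _ hnd,
        ← List.sum_toFinset _ (nodup_rowGraph f), hF]
    · have := two_mul_sum_of_detFun_ne_zero _ _ _ hd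
      change 2 * sr G = _ at this
      omega
  · by_cases hnd : S.Nodup
    · by_contra hne
      rw [hψ S hnd, LinearMap.smul_apply, smul_eq_mul] at hne
      have hp := perm_of_detFun_ne_zero _ _ _ (right_ne_zero_of_mul hne)
      obtain ⟨g, hg, hgr⟩ := List.mem_map.1 (hp.mem_iff.2 (List.mem_finRange r))
      exact hr g hg hgr
    · rw [lp_eq_zero_of_not_nodup _ hnd, map_zero]
  · rw [hψ _ (nodup_rowGraph f), LinearMap.smul_apply, detFun_lp_eq_one _ _ _ (map_snd_rowGraph f),
      Finset.sum_eq_single f, if_pos rfl, smul_eq_mul, mul_one]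
    · intro f' _ hne
      exact if_neg fun h => hne (rowGraph_toFinset_injective h)
    · intro h
      exact absurd (Finset.mem_univ f) h

/-- A cocycle supported on full rows with an almost constant potential is a coboundary. -/
lemma IsCocycle.exists_cochain_of_potential (h : IsCocycle b t₁ t₂ Φ) (hE : RowFull b Φ)
    (ht : 2 * t₂ = a * (a + 1)) {p : (Fin (a + 1) → Fin (a + 1)) → k} (hp : ∀ f r i,
      Φ (lp k b ((i, r) :: rowGraph f)) = p f - p (Function.update f r i)) (c : k)
    (hc : ∀ f, ∑ s, ((f s : ℕ) : ℤ) ≠ t₁ → p f = c) :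
    ∃ ψ, IsCochain b t₁ t₂ ψ ∧ Φ = ψ ∘ₗ ctr (aug b) := by
  obtain ⟨ψ, hψ, hψE, hval⟩ := exists_cochain_of_rowGraph (b := b) (t₁ := t₁) (fun f => p f - c) ht
    fun f hf => by
      by_contra h0
      exact hf (by rw [hc f h0, sub_self])
  refine ⟨ψ, hψ, ext_lp_grid b fun S => ?_⟩
  by_cases hr : ∃ r, ∀ g ∈ S, g.2 ≠ r
  · obtain ⟨r, hr⟩ := hr
    rw [hE S r hr, LinearMap.comp_apply, map_ctr_lp_eq_zero]
    intro A g B hAB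
    refine Or.inr (hψE _ r fun x hx => hr x ?_)
    rw [hAB]
    simp at hx ⊢
    tauto
  · push Not at hr
    by_cases hlen : S.length = a + 2
    · obtain ⟨f, ⟨i, r⟩, hS⟩ := perm_cons_rowGraph hlen hr
      obtain ⟨s, -, hs⟩ := lp_perm (k := k) b hS
      rw [hs, map_smul, map_smul, hp, LinearMap.comp_apply, map_ctr_cons_rowGraph, hval, hval,
        sub_sub_sub_cancel_right]
      intro A g B hAB hg
      refine hψE.apply_append (S := [(i, r)]) hAB fun x hx => ?_
      rw [List.mem_singleton.1 hx]
      exact hg.symm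
    · have h1 : Φ (lp k b S) = 0 := by
        by_contra hne
        exact hlen (h.supp S hne).1
      have h2 : (ψ ∘ₗ ctr (aug b)) (lp k b S) = 0 := by
        by_contra hne
        exact hlen (hψ.isCocycle.supp S hne).1
      rw [h1, h2]

lemma IsCochain.add {ψ'} (h : IsCochain b t₁ t₂ ψ) (h' : IsCochain b t₁ t₂ ψ') :
    IsCochain b t₁ t₂ (ψ + ψ') := by
  intro G hne
  by_cases h0 : ψ (lp k b G) = 0
  · exact h' G (by simpa [h0] using hne)
  · exact h G h0

lemma IsCochain.om_eq_zero (h : IsCochain b t₁ t₂ ψ) (ht : 2 * t₂ = a * (a + 1)) (h0 : 0 < t₁)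
    (h1 : t₁ < a * (a + 1)) : (ψ ∘ₗ ctr (aug b)) (om b) = 0 := by
  rw [LinearMap.comp_apply, map_ctr_om ψ fun S hS => by rw [(h S hS).2.2, ht]]
  have e0 : ψ (lp k b (rowGraph fun _ => 0)) = 0 := by
    by_contra hne
    have := (h _ hne).2.1
    simp [sc_rowGraph] at this
    omega
  have e1 : ψ (lp k b (rowGraph fun _ => Fin.last a)) = 0 := by
    by_contra hne
    have := (h _ hne).2.1
    simp [sc_rowGraph] at this
    nlinarith
  rw [e0, e1, sub_zero]

lemma IsCochain.th_eq_zero (h : IsCochain b t₁ t₂ ψ) (W) (h0 : sr W < t₂) (h1 : t₂ < sr W + a) :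
    th b (ψ ∘ₗ ctr (aug b)) W = 0 := by
  rw [th, LinearMap.comp_apply, ctr_wl _ _ (aug_wv b), map_smul, ctr_lp_cons, ctr_lp_cons]
  simp only [aug_apply, one_smul, lp_nil, ctr_one, mul_zero, sub_zero, mul_one, mul_sub, map_sub,
    ← lp_singleton (k := k) b]
  change (-1 : k) ^ W.length • (ψ (wl k b W [_]) - ψ (wl k b W [_])) = 0
  rw [map_wl_eq_zero, map_wl_eq_zero, sub_zero, smul_zero]
  all_goals
    intro L _ hL _ _
    by_contra hne
    have := (h L hne).2.2
    simp at hL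
    omega

/-- A cocycle annihilated by the two test chains is a coboundary. -/
lemma IsCocycle.exists_cochain (ha : 3 ≤ a) (h : IsCocycle b t₁ t₂ Φ)
    (hom : 2 * t₂ = a * (a + 1) → 0 < t₁ → t₁ < a * (a + 1) → Φ (om b) = 0)
    (hΘ : 2 * t₁ = a * (a + 1) → 0 < t₂ → t₂ < a * (a + 1) → ∃ f : Fin a → Fin (a + 1),
      sr (graphList f) < t₂ ∧ t₂ < sr (graphList f) + a ∧ th b Φ (graphList f) = 0) :
    ∃ ψ, IsCochain b t₁ t₂ ψ ∧ Φ = ψ ∘ₗ ctr (aug b) := by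
  have hZ : RowClosed b t₂ Φ := h.row_ctr (by omega) (h.theta_eq_zero ha hΘ)
  obtain ⟨ψ, hψ, hE⟩ := exists_rowFull h hZ
  have h' := h.sub hψ.isCocycle
  have hZ' := hZ.sub hψ.rowClosed
  suffices H : ∃ ψ', IsCochain b t₁ t₂ ψ' ∧ Φ - ψ ∘ₗ ctr (aug b) = ψ' ∘ₗ ctr (aug b) by
    obtain ⟨ψ', hψ', e⟩ := H
    exact ⟨ψ + ψ', hψ.add hψ', by rw [LinearMap.add_comp, ← e, add_sub_cancel]⟩
  by_cases ht : 2 * t₂ = a * (a + 1)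
  swap
  · refine ⟨0, fun G hG => absurd rfl hG, ?_⟩
    rw [h'.eq_zero_of_rowFull (by omega) hZ' hE ht, LinearMap.zero_comp]
  obtain ⟨p, hp⟩ := h'.exists_potential hE
  have key : ∃ c, ∀ f : Fin (a + 1) → Fin (a + 1), ∑ s, ((f s : ℕ) : ℤ) ≠ t₁ → p f = c := by
    by_cases h1 : t₁ < a * (a + 1)
    · refine ⟨p fun _ => Fin.last a, fun f hf => ?_⟩
      rcases lt_or_gt_of_ne hf with hlt | hgt
      · have h0 : 0 < t₁ := lt_of_le_of_lt (Finset.sum_nonneg fun _ _ => by positivity) hlt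
        rw [h'.potential_eq_zero hp f hlt, ← sub_eq_zero, ← sum_stair_sub p]
        simp_rw [← hp]
        rw [← map_sum, ← om, LinearMap.sub_apply, hom ht h0 h1, hψ.om_eq_zero ht h0 h1, sub_zero]
      · exact h'.potential_eq_last hp f hgt
    · refine ⟨p fun _ => 0, fun f hf => h'.potential_eq_zero hp f (lt_of_le_of_ne ?_ hf)⟩
      refine le_trans ?_ (not_lt.1 h1)
      calc ∑ s, ((f s : ℕ) : ℤ) ≤ ∑ s : Fin (a + 1), (a : ℤ) :=
            Finset.sum_le_sum fun s _ => by have := (f s).2; omega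
        _ = a * (a + 1) := by simp; ring
  obtain ⟨c, hc⟩ := key
  exact h'.exists_cochain_of_potential hE ht hp c hc

end
end SegreCross

namespace SegreCross

variable {k V : Type*} [Field k] [AddCommGroup V] [Module k V] {a : ℕ}

lemma exists_sum_eq (m n s : ℕ) (hs : s ≤ n * m) :
    ∃ f : Fin n → Fin (m + 1), ∑ i, (f i : ℕ) = s := by
  induction n generalizing s with
  | zero => exact ⟨Fin.elim0, by simp; omega⟩
  | succ n ih =>
    rw [add_mul, one_mul] at hs
    obtain ⟨f, hf⟩ := ih (s - min s m) (by omega)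
    refine ⟨Fin.cons ⟨min s m, by omega⟩ f, ?_⟩
    rw [Fin.sum_univ_succ]
    simp [hf]

lemma exists_graphList (ha : 2 ≤ a) (t : ℤ) (h0 : 0 < t) (h1 : t < a * (a + 1)) :
    ∃ f : Fin a → Fin (a + 1), sr (graphList f) < t ∧ t < sr (graphList f) + a := by
  obtain ⟨f, hf⟩ := exists_sum_eq a a (min (t - 1).toNat (a * a)) (min_le_right _ _)
  have e : sr (graphList f) = (min (t - 1).toNat (a * a) : ℕ) := by
    rw [sr_graphList, ← hf]
    push_cast
    rfl
  refine ⟨f, ?_⟩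
  rw [e]
  rw [mul_add, mul_one] at h1
  push_cast
  rw [Int.toNat_of_nonneg (by omega)]
  generalize (a : ℤ) * a = A at *
  omega

section
variable (b : Module.Basis (Pt a) k V) {t₁ t₂ : ℤ}

/-- The class of central row weight. -/
lemma exists_row_class (ht : 2 * t₂ = a * (a + 1)) (h0 : 0 < t₁) (h1 : t₁ < a * (a + 1)) :
    ∃ Φ, IsCocycle b t₁ t₂ Φ ∧ Φ (om b) = -1 := by
  obtain ⟨ψ, hval, hsupp⟩ := exists_class b Prod.snd Prod.fst t₁
  refine ⟨ψ ∘ₗ ctr (aug b), ⟨fun x => by rw [LinearMap.comp_apply, ctr_ctr, map_zero],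
    fun S hne => ?_⟩, ?_⟩
  · obtain ⟨hl, h2, h3, s, hs⟩ := hsupp S hne
    change t₁ ≤ sc S at h2
    change sc S ≤ _ at h3
    change 2 * (sr S - _) = _ at hs
    have := s.2
    omega
  · rw [LinearMap.comp_apply, map_ctr_om, hval, hval, if_neg, if_pos,
      detFun_lp_eq_one _ _ _ (map_snd_rowGraph _), zero_sub]
    · change t₁ < sc _
      rw [sc_rowGraph]
      simp
      linarith
    · change ¬ t₁ < sc _
      rw [sc_rowGraph]
      simp
      exact h0.le
    · intro S hS
      rw [hval] at hS
      refine two_mul_sum_of_detFun_ne_zero b Prod.snd S fun h => hS ?_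
      rw [h, ite_self]

lemma detFun_wl_graphList (f : Fin a → Fin (a + 1)) (r) :
    detFun b Prod.fst (wl k b (graphList f) [(Fin.last a, r)]) = 1 := by
  let v : Fin (a + 1) → V := Fin.lastCases (b (Fin.last a, r)) fun i => wv b (i, f i)
  have e : wl k b (graphList f) [(Fin.last a, r)] = lp k (fun x : V => x) (List.ofFn v) := by
    rw [List.ofFn_succ', List.concat_eq_append, lp_append, lp_singleton, wl, lp_singleton]
    simp only [v, Fin.lastCases_last, Fin.lastCases_castSucc]
    rw [lp, lp, graphList, List.ofFn_eq_map, List.map_map, List.map_map]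
    rfl
  rw [e, detFun, LinearMap.comp_apply, AlgHom.toLinearMap_apply, map_lp, topDet_lp_ofFn,
    Matrix.det_of_isUpperTriangular, Finset.prod_eq_one]
  · intro i _
    induction i using Fin.lastCases with
    | last => simp [v, coordProj_apply]
    | cast i =>
      have h1 : i.castSucc ≠ i.succ := Fin.castSucc_lt_succ.ne
      simp [v, wv, coordProj_apply, h1]
  · intro i j hij
    simp only [id] at hij
    induction i using Fin.lastCases with
    | last => simp [v, coordProj_apply, hij.ne]
    | cast i =>
      have h1 : j ≠ i.succ := (hij.trans Fin.castSucc_lt_succ).ne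
      simp [v, wv, coordProj_apply, hij.ne, h1]

/-- The class of central column weight. -/
lemma exists_column_class (ha : 2 ≤ a) (ht : 2 * t₁ = a * (a + 1)) (f : Fin a → Fin (a + 1))
    (h0 : sr (graphList f) < t₂) (h1 : t₂ < sr (graphList f) + a) :
    ∃ Φ, IsCocycle b t₁ t₂ Φ ∧ Φ (om b) = 0 ∧ th b Φ (graphList f) ≠ 0 := by
  obtain ⟨ψ, hval, hsupp⟩ := exists_class b Prod.fst Prod.snd t₂
  refine ⟨ψ ∘ₗ ctr (aug b), ⟨fun x => by rw [LinearMap.comp_apply, ctr_ctr, map_zero],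
    fun S hne => ?_⟩, ?_, ?_⟩
  · obtain ⟨hl, h2, h3, s, hs⟩ := hsupp S hne
    change t₂ ≤ sr S at h2
    change sr S ≤ _ at h3
    change 2 * (sc S - _) = _ at hs
    have := s.2
    omega
  · rw [om, map_sum]
    refine Finset.sum_eq_zero fun r _ => ?_
    rw [LinearMap.comp_apply]
    refine map_ctr_lp_eq_zero _ _ _ _ fun A g B hAB => Or.inr ?_
    rw [hval]
    split_ifs
    swap
    · rfl
    by_contra hne
    have hp := perm_of_detFun_ne_zero _ _ _ hne
    obtain ⟨x, hx, hx1⟩ := List.mem_map.1 (hp.mem_iff.2 (List.mem_finRange ⟨1, by omega⟩))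
    have hx' : x ∈ (Fin.last a, r) :: rowGraph (stair a r) := by
      rw [hAB]
      simp at hx ⊢
      tauto
    rw [List.mem_cons, mem_rowGraph, stair] at hx'
    have hx2 := congrArg Fin.val hx1
    simp at hx2
    rcases hx' with rfl | hx'
    · simp at hx2
      omega
    · have := congrArg Fin.val hx'
      split_ifs at this
      · simp at this
        omega
      · simp at this
        omega
  · rw [th, LinearMap.comp_apply, ctr_wl _ _ (aug_wv b), map_smul, ctr_lp_cons, ctr_lp_cons]
    simp only [aug_apply, one_smul, lp_nil, ctr_one, mul_zero, sub_zero, mul_one, mul_sub, map_sub,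
      ← lp_singleton (k := k) b]
    change (-1 : k) ^ _ • (ψ (wl k b (graphList f) [_]) - ψ (wl k b (graphList f) [_])) ≠ 0
    have e0 : ψ (wl k b (graphList f) [(Fin.last a, 0)]) = 0 := by
      refine map_wl_eq_zero _ _ _ _ fun L _ hL _ _ => ?_
      rw [hval, if_neg]
      change ¬ t₂ < sr L
      simp at hL
      omega
    have e1 : ψ (wl k b (graphList f) [(Fin.last a, Fin.last a)]) = 1 := by
      rw [← detFun_wl_graphList b f (Fin.last a), ← sub_eq_zero, ← LinearMap.sub_apply]
      refine map_wl_eq_zero _ _ _ _ fun L _ hL _ _ => ?_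
      rw [LinearMap.sub_apply, hval, if_pos, sub_self]
      change t₂ < sr L
      simp at hL
      omega
    rw [e0, e1, sub_zero, smul_eq_mul, mul_one]
    exact pow_ne_zero _ (neg_ne_zero.2 one_ne_zero)

end
end SegreCross

namespace SegreCross

variable {k V : Type*} [Field k] [AddCommGroup V] [Module k V] {a : ℕ}

/-- Sum of the coordinates over the grid. -/
def tot (a : ℕ) : ℤ := ∑ i : Fin (a + 1), (a + 1) * ((i : ℕ) : ℤ)

lemma two_mul_tot (a : ℕ) : 2 * tot a = a * (a + 1) * (a + 1) := by
  have := two_mul_sum_fin (a + 1)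
  rw [tot, ← Finset.mul_sum, mul_left_comm, this]
  push_cast
  ring

lemma complete_list {S : List (Pt a)} (hnd : S.Nodup) (hS : ∀ x, x ∈ S) :
    S.length = (a + 1) * (a + 1) ∧ sc S = tot a ∧ sr S = tot a := by
  have hu : S.toFinset = Finset.univ := by
    ext x
    simp [hS x]
  refine ⟨?_, ?_, ?_⟩
  · rw [← List.toFinset_card_of_nodup hnd, hu]
    simp
  · rw [sc, ← List.sum_toFinset _ hnd, hu, Fintype.sum_prod_type, tot]
    simp
  · rw [sr, ← List.sum_toFinset _ hnd, hu, Fintype.sum_prod_type_right, tot]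
    simp

/-- The part of fine bidegree `(u₁, u₂)` of the Koszul complex. -/
def chains (b : Module.Basis (Pt a) k V) (p q : ℕ) (u₁ u₂ : ℤ) :
    Submodule k (ExteriorAlgebra k V) :=
  Submodule.span k {x | ∃ S, S.length = p ∧ sc S ≤ u₁ ∧ u₁ ≤ sc S + q * a ∧
    sr S ≤ u₂ ∧ u₂ ≤ sr S + q * a ∧ x = lp k b S}

lemma exists_vol (b : Module.Basis (Pt a) k V) : ∃ vol : ExteriorAlgebra k V →ₗ[k] k,
    ∀ S, vol (lp k b S) ≠ 0 ↔ S.Nodup ∧ ∀ x, x ∈ S := by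
  classical
  let : LinearOrder (Pt a) := LinearOrder.lift' toLex toLex.injective
  refine ⟨b.ExteriorAlgebra.coord Finset.univ, fun S => ?_⟩
  by_cases hnd : S.Nodup
  · obtain ⟨s, hs, e⟩ := exists_lp_eq_basis b hnd (F := S.toFinset) (by simp)
    have hs0 : s ≠ 0 := by
      rintro rfl
      simp at hs
    rw [e, map_smul, smul_ne_zero_iff, Module.Basis.coord_apply, Module.Basis.repr_self,
      Finsupp.single_apply]
    simp [hs0, hnd, Finset.eq_univ_iff_forall]
  · simp [hnd, lp_eq_zero_of_not_nodup _ hnd]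

/-- A top degree coordinate on the exterior algebra. -/
def vol (b : Module.Basis (Pt a) k V) : ExteriorAlgebra k V →ₗ[k] k := (exists_vol b).choose

lemma vol_ne_zero_iff (b : Module.Basis (Pt a) k V) (S) :
    vol b (lp k b S) ≠ 0 ↔ S.Nodup ∧ ∀ x, x ∈ S := (exists_vol b).choose_spec S

/-- Multiplication followed by projection to the top degree. -/
def star (b : Module.Basis (Pt a) k V) :
    ExteriorAlgebra k V →ₗ[k] ExteriorAlgebra k V →ₗ[k] k :=
  (LinearMap.mul k (ExteriorAlgebra k V)).compr₂ (vol b)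

lemma star_apply (b : Module.Basis (Pt a) k V) (c x) : star b c x = vol b (c * x) := rfl

section
variable {b : Module.Basis (Pt a) k V}

lemma vol_ctr (b : Module.Basis (Pt a) k V) (d : Module.Dual k V) (x) : vol b (ctr d x) = 0 := by
  suffices h : vol b ∘ₗ ctr d = 0 from LinearMap.congr_fun h x
  refine ext_lp_grid b fun S => ?_
  by_cases hnd : S.Nodup
  swap
  · rw [lp_eq_zero_of_not_nodup _ hnd, map_zero, map_zero]
  refine map_ctr_lp_eq_zero _ _ _ _ fun A g B hAB => Or.inr ?_
  by_contra hne
  have := ((vol_ne_zero_iff b _).1 hne).2 g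
  rw [hAB, List.nodup_middle, List.nodup_cons] at hnd
  exact hnd.1 this

lemma star_ctr_lp (d : Module.Dual k V) (S) :
    star b (ctr d (lp k b S)) = -(-1 : k) ^ S.length • (star b (lp k b S) ∘ₗ ctr d) := by
  refine LinearMap.ext fun x => ?_
  have h := vol_ctr b d (lp k b S * x)
  rw [ctr_lp_mul, map_add, map_smul] at h
  simp only [star_apply, neg_smul]
  exact eq_neg_of_add_eq_zero_left h

lemma star_ctr {p q : ℕ} {u₁ u₂ : ℤ} {c} (hc : c ∈ chains b p q u₁ u₂) (d : Module.Dual k V) :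
    star b (ctr d c) = -(-1 : k) ^ p • (star b c ∘ₗ ctr d) := by
  rw [chains] at hc
  induction hc using Submodule.span_induction with
  | mem x hx =>
    obtain ⟨S, rfl, -, -, -, -, rfl⟩ := hx
    exact star_ctr_lp d S
  | zero => simp
  | add x y _ _ hx hy => rw [map_add, map_add, hx, hy, map_add, LinearMap.add_comp, smul_add]
  | smul r x _ hx => rw [map_smul, map_smul, hx, map_smul, LinearMap.smul_comp, smul_comm]

lemma star_supp {p q : ℕ} {u₁ u₂ : ℤ} {c} (hc : c ∈ chains b p q u₁ u₂) (S)
    (hne : star b c (lp k b S) ≠ 0) : S.length + p = (a + 1) * (a + 1) ∧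
      tot a - u₁ ≤ sc S ∧ sc S ≤ tot a - u₁ + q * a ∧
      tot a - u₂ ≤ sr S ∧ sr S ≤ tot a - u₂ + q * a := by
  by_contra hcon
  apply hne
  clear hne
  rw [chains] at hc
  induction hc using Submodule.span_induction with
  | mem x hx =>
    obtain ⟨T, hl, h1, h2, h3, h4, rfl⟩ := hx
    by_contra hne
    rw [star_apply, ← lp_append, ← ne_eq, vol_ne_zero_iff] at hne
    have := complete_list hne.1 hne.2
    simp at this
    omega
  | zero => simp
  | add x y _ _ hx hy => rw [map_add, LinearMap.add_apply, hx, hy, add_zero]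
  | smul r x _ hx => rw [map_smul, LinearMap.smul_apply, hx, smul_zero]

lemma exists_compl_list (S : List (Pt a)) : ∃ T : List (Pt a), T.Nodup ∧ ∀ x, x ∈ T ↔ x ∉ S := by
  classical
  exact ⟨(Finset.univ.filter fun x => x ∉ S).toList, Finset.nodup_toList _, by simp⟩

/-- An element of the exterior algebra is determined by its pairings with products of basis
vectors. -/
lemma mem_of_star {c} (M : Submodule k (ExteriorAlgebra k V))
    (h : ∀ S T, (S ++ T).Nodup → (∀ x, x ∈ S ++ T) → star b c (lp k b T) ≠ 0 → lp k b S ∈ M) :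
    c ∈ M := by
  classical
  let : LinearOrder (Pt a) := LinearOrder.lift' toLex toLex.injective
  rw [← b.ExteriorAlgebra.sum_repr c]
  refine M.sum_mem fun F _ => ?_
  by_cases h0 : b.ExteriorAlgebra.repr c F = 0
  · rw [h0, zero_smul]
    exact M.zero_mem
  refine M.smul_mem _ ?_
  obtain ⟨S, hS, hFS, e⟩ := basis_eq_lp b F
  obtain ⟨T, hT, hTS⟩ := exists_compl_list S
  have hnd : (S ++ T).Nodup := by
    rw [List.nodup_append']
    exact ⟨hS, hT, fun x hx hx' => (hTS x).1 hx' hx⟩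
  have hall : ∀ x, x ∈ S ++ T := fun x => by
    rw [List.mem_append, hTS]
    exact em _
  rw [e]
  refine h S T hnd hall ?_
  rw [star_apply, ← b.ExteriorAlgebra.sum_repr c, Finset.sum_mul, map_sum,
    Finset.sum_eq_single F]
  · rw [smul_mul_assoc, map_smul, e, ← lp_append]
    exact smul_ne_zero h0 ((vol_ne_zero_iff b _).2 ⟨hnd, hall⟩)
  · intro G _ hGF
    rw [smul_mul_assoc, map_smul]
    obtain ⟨S', hS', hGS', e'⟩ := basis_eq_lp b G
    rw [e', ← lp_append]
    by_contra hne
    obtain ⟨hnd', hall'⟩ := (vol_ne_zero_iff b _).1 (right_ne_zero_of_mul hne)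
    apply hGF
    ext x
    rw [hGS', hFS]
    have h1 := hall' x
    rw [List.mem_append, hTS] at h1
    refine ⟨fun hx => ?_, fun hx => by tauto⟩
    by_contra hx'
    exact (List.disjoint_of_nodup_append hnd') hx ((hTS x).2 hx')
  · intro h
    exact absurd (Finset.mem_univ F) h

lemma star_injective (b : Module.Basis (Pt a) k V) : Function.Injective (star b) := by
  rw [injective_iff_map_eq_zero]
  intro c hc
  rw [← Submodule.mem_bot k]
  refine mem_of_star (b := b) _ fun S T _ _ h => ?_
  rw [hc] at h
  exact absurd rfl h

lemma star_surjective (b : Module.Basis (Pt a) k V) : Function.Surjective (star b) := by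
  let : LinearOrder (Pt a) := LinearOrder.lift' toLex toLex.injective
  have : FiniteDimensional k (ExteriorAlgebra k V) := b.ExteriorAlgebra.finiteDimensional_of_finite
  exact (LinearMap.injective_iff_surjective_of_finrank_eq_finrank
    (Subspace.dual_finrank_eq (K := k) (V := ExteriorAlgebra k V)).symm).1 ((star_injective b))

lemma mem_chains_of_star {p q : ℕ} {u₁ u₂ : ℤ} {c}
    (h : ∀ S, star b c (lp k b S) ≠ 0 → S.length + p = (a + 1) * (a + 1) ∧
      tot a - u₁ ≤ sc S ∧ sc S ≤ tot a - u₁ + q * a ∧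
      tot a - u₂ ≤ sr S ∧ sr S ≤ tot a - u₂ + q * a) : c ∈ chains b p q u₁ u₂ := by
  refine mem_of_star (b := b) _ fun S T hnd hall hne => Submodule.subset_span ⟨S, ?_⟩
  have h1 := h T hne
  have h2 := complete_list hnd hall
  simp only [List.length_append, sc_append, sr_append] at h2
  refine ⟨?_, ?_, ?_, ?_, ?_, rfl⟩ <;> omega

lemma isCocycle_star_iff {p : ℕ} (hp : p + (a + 2) = (a + 1) * (a + 1)) {u₁ u₂ : ℤ} {c} :
    IsCocycle b (tot a - u₁) (tot a - u₂) (star b c) ↔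
      c ∈ chains b p 1 u₁ u₂ ∧ ctr (aug b) c = 0 := by
  constructor
  · intro h
    have hc : c ∈ chains b p 1 u₁ u₂ := mem_chains_of_star fun S hS => by
      have := h.supp S hS
      omega
    refine ⟨hc, (star_injective b) ?_⟩
    rw [star_ctr hc, map_zero]
    convert smul_zero _
    exact LinearMap.ext h.closed
  · rintro ⟨hc, h0⟩
    refine ⟨fun x => ?_, fun S hS => ?_⟩
    · have := LinearMap.congr_fun (star_ctr hc (aug b)) x
      rw [h0, map_zero, LinearMap.zero_apply, LinearMap.smul_apply, eq_comm, smul_eq_zero,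
        neg_eq_zero] at this
      exact this.resolve_left (pow_ne_zero _ (neg_ne_zero.2 one_ne_zero))
    · have := star_supp hc S hS
      omega

lemma isCochain_star_iff {p : ℕ} (hp : p + (a + 1) = (a + 1) * (a + 1)) {u₁ u₂ : ℤ} {c} :
    IsCochain b (tot a - u₁) (tot a - u₂) (star b c) ↔ c ∈ chains b p 0 u₁ u₂ := by
  constructor
  · refine fun h => mem_chains_of_star fun S hS => ?_
    have := h S hS
    omega
  · intro hc S hS
    have := star_supp hc S hS
    omega

lemma exists_boundary_iff {p : ℕ} (hp : p + 1 + (a + 1) = (a + 1) * (a + 1)) {u₁ u₂ : ℤ} {c} :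
    (∃ ψ, IsCochain b (tot a - u₁) (tot a - u₂) ψ ∧ star b c = ψ ∘ₗ ctr (aug b)) ↔
      ∃ x ∈ chains b (p + 1) 0 u₁ u₂, ctr (aug b) x = c := by
  have hu : (-(-1 : k) ^ (p + 1)) * (-(-1 : k) ^ (p + 1)) = 1 := by
    rw [neg_mul_neg, ← mul_pow]
    simp
  constructor
  · rintro ⟨ψ, hψ, e⟩
    obtain ⟨x, rfl⟩ := star_surjective b ψ
    have hx := (isCochain_star_iff hp).1 hψ
    refine ⟨(-(-1 : k) ^ (p + 1)) • x, Submodule.smul_mem _ _ hx, (star_injective b) ?_⟩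
    rw [map_smul, map_smul, star_ctr hx, smul_smul, hu, one_smul, e]
  · rintro ⟨x, hx, rfl⟩
    have hx' := Submodule.smul_mem _ (-(-1 : k) ^ (p + 1)) hx
    refine ⟨_, (isCochain_star_iff hp).2 hx', ?_⟩
    rw [star_ctr hx, map_smul, LinearMap.smul_comp]

end
end SegreCross

namespace SegreCross

variable {k V : Type*} [Field k] [AddCommGroup V] [Module k V] {a : ℕ}

/-- The cycles of fine bidegree `(u₁, u₂)` in the Koszul complex. -/
def cycles (b : Module.Basis (Pt a) k V) (p : ℕ) (u₁ u₂ : ℤ) : Submodule k (ExteriorAlgebra k V) :=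
  chains b p 1 u₁ u₂ ⊓ LinearMap.ker (ctr (aug b))

lemma mem_cycles_iff {b : Module.Basis (Pt a) k V} {p : ℕ} {u₁ u₂ : ℤ} {c} :
    c ∈ cycles b p u₁ u₂ ↔ c ∈ chains b p 1 u₁ u₂ ∧ ctr (aug b) c = 0 := Iff.rfl

/-- The homology in fine bidegree `(u₁, u₂)` is identified with the space of `r`-tuples. -/
def HasHomology (b : Module.Basis (Pt a) k V) (p : ℕ) (u₁ u₂ : ℤ) (r : ℕ) : Prop :=
  ∃ L : ExteriorAlgebra k V →ₗ[k] Fin r → k,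
    (∀ c ∈ cycles b p u₁ u₂, L c = 0 ↔ ∃ x ∈ chains b (p + 1) 0 u₁ u₂, ctr (aug b) x = c) ∧
    ∀ y, ∃ c ∈ cycles b p u₁ u₂, L c = y

section
variable {b : Module.Basis (Pt a) k V} {p : ℕ} {u₁ u₂ : ℤ}

lemma hasHomology_of_test (hp : p + (a + 2) = (a + 1) * (a + 1)) {r : ℕ}
    (ω : Fin r → ExteriorAlgebra k V)
    (hker : ∀ Φ, IsCocycle b (tot a - u₁) (tot a - u₂) Φ → (∀ i, Φ (ω i) = 0) →
      ∃ ψ, IsCochain b (tot a - u₁) (tot a - u₂) ψ ∧ Φ = ψ ∘ₗ ctr (aug b))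
    (hbd : ∀ ψ, IsCochain b (tot a - u₁) (tot a - u₂) ψ → ∀ i, (ψ ∘ₗ ctr (aug b)) (ω i) = 0)
    (hsurj : ∀ y : Fin r → k, ∃ c ∈ cycles b p u₁ u₂, ∀ i, star b c (ω i) = y i) :
    HasHomology b p u₁ u₂ r := by
  refine ⟨LinearMap.pi fun i => (star b).flip (ω i), fun c hc => ?_, fun y => ?_⟩
  · rw [← exists_boundary_iff (by omega)]
    refine ⟨fun h => ?_, ?_⟩
    · exact hker _ ((isCocycle_star_iff hp).2 (mem_cycles_iff.1 hc)) fun i => congrFun h i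
    · rintro ⟨ψ, hψ, e⟩
      ext i
      rw [LinearMap.pi_apply, LinearMap.flip_apply, e, hbd ψ hψ i, Pi.zero_apply]
  · obtain ⟨c, hc, h⟩ := hsurj y
    exact ⟨c, hc, funext h⟩

lemma exists_cycle_of_cocycle (hp : p + (a + 2) = (a + 1) * (a + 1)) {Φ}
    (h : IsCocycle b (tot a - u₁) (tot a - u₂) Φ) : ∃ c ∈ cycles b p u₁ u₂, star b c = Φ := by
  obtain ⟨c, rfl⟩ := star_surjective b Φ
  exact ⟨c, mem_cycles_iff.2 ((isCocycle_star_iff hp).1 h), rfl⟩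

lemma hasHomology_two (ha : 3 ≤ a) (hp : p + (a + 2) = (a + 1) * (a + 1))
    (h1 : 2 * (tot a - u₁) = a * (a + 1)) (h2 : 2 * (tot a - u₂) = a * (a + 1)) :
    HasHomology b p u₁ u₂ 2 := by
  have hpos : (0 : ℤ) < a * (a + 1) := by positivity
  obtain ⟨f, hf0, hf1⟩ := exists_graphList (a := a) (by omega) (tot a - u₂) (by omega) (by omega)
  refine hasHomology_of_test hp
    ![om b, wl k b (graphList f) [(Fin.last a, 0), (Fin.last a, Fin.last a)]] ?_ ?_ ?_
  · intro Φ hΦ h0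
    exact hΦ.exists_cochain ha (fun _ _ _ => h0 0) fun _ _ _ => ⟨f, hf0, hf1, h0 1⟩
  · intro ψ hψ
    rw [Fin.forall_fin_two]
    exact ⟨hψ.om_eq_zero h2 (by omega) (by omega), hψ.th_eq_zero _ hf0 hf1⟩
  · intro y
    obtain ⟨Φ, hΦ, e⟩ := exists_row_class b (t₁ := tot a - u₁) h2 (by omega) (by omega)
    obtain ⟨Φ', hΦ', e', hne⟩ := exists_column_class b (by omega) h1 f hf0 hf1
    obtain ⟨c, hc, rfl⟩ := exists_cycle_of_cocycle hp hΦ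
    obtain ⟨c', hc', rfl⟩ := exists_cycle_of_cocycle hp hΦ'
    rw [th] at hne
    refine ⟨(-y 0) • c + ((y 1 + y 0 * th b (star b c) (graphList f)) /
      th b (star b c') (graphList f)) • c',
      Submodule.add_mem _ (Submodule.smul_mem _ _ hc) (Submodule.smul_mem _ _ hc'), ?_⟩
    rw [Fin.forall_fin_two]
    refine ⟨?_, ?_⟩
    · simp [e, e']
    · simp only [map_add, map_smul, LinearMap.add_apply, LinearMap.smul_apply, th, smul_eq_mul,
        Matrix.cons_val_one, Matrix.cons_val_fin_one]
      rw [div_mul_cancel₀ _ hne]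
      ring

lemma hasHomology_row (ha : 3 ≤ a) (hp : p + (a + 2) = (a + 1) * (a + 1))
    (h1 : 2 * (tot a - u₁) ≠ a * (a + 1)) (h2 : 2 * (tot a - u₂) = a * (a + 1))
    (h3 : 0 < tot a - u₁) (h4 : tot a - u₁ < a * (a + 1)) : HasHomology b p u₁ u₂ 1 := by
  refine hasHomology_of_test hp ![om b] ?_ ?_ ?_
  · intro Φ hΦ h0
    exact hΦ.exists_cochain ha (fun _ _ _ => h0 0) fun h => absurd h h1
  · intro ψ hψ
    rw [Fin.forall_fin_one]
    exact hψ.om_eq_zero h2 h3 h4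
  · intro y
    obtain ⟨Φ, hΦ, e⟩ := exists_row_class b (t₁ := tot a - u₁) h2 h3 h4
    obtain ⟨c, hc, rfl⟩ := exists_cycle_of_cocycle hp hΦ
    refine ⟨(-y 0) • c, Submodule.smul_mem _ _ hc, ?_⟩
    rw [Fin.forall_fin_one]
    simp [e]

lemma hasHomology_column (ha : 3 ≤ a) (hp : p + (a + 2) = (a + 1) * (a + 1))
    (h1 : 2 * (tot a - u₁) = a * (a + 1)) (h2 : 2 * (tot a - u₂) ≠ a * (a + 1))
    (h3 : 0 < tot a - u₂) (h4 : tot a - u₂ < a * (a + 1)) : HasHomology b p u₁ u₂ 1 := by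
  obtain ⟨f, hf0, hf1⟩ := exists_graphList (a := a) (by omega) (tot a - u₂) h3 h4
  refine hasHomology_of_test hp
    ![wl k b (graphList f) [(Fin.last a, 0), (Fin.last a, Fin.last a)]] ?_ ?_ ?_
  · intro Φ hΦ h0
    exact hΦ.exists_cochain ha (fun h => absurd h h2) fun _ _ _ => ⟨f, hf0, hf1, h0 0⟩
  · intro ψ hψ
    rw [Fin.forall_fin_one]
    exact hψ.th_eq_zero _ hf0 hf1
  · intro y
    obtain ⟨Φ', hΦ', -, hne⟩ := exists_column_class b (by omega) h1 f hf0 hf1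
    obtain ⟨c', hc', rfl⟩ := exists_cycle_of_cocycle hp hΦ'
    rw [th] at hne
    refine ⟨(y 0 / th b (star b c') (graphList f)) • c', Submodule.smul_mem _ _ hc', ?_⟩
    rw [Fin.forall_fin_one]
    simp only [map_smul, LinearMap.smul_apply, th, smul_eq_mul, Matrix.cons_val_fin_one]
    rw [div_mul_cancel₀ _ hne]

lemma hasHomology_zero (ha : 3 ≤ a) (hp : p + (a + 2) = (a + 1) * (a + 1))
    (h1 : 2 * (tot a - u₂) = a * (a + 1) → 0 < tot a - u₁ → ¬ tot a - u₁ < a * (a + 1))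
    (h2 : 2 * (tot a - u₁) = a * (a + 1) → 0 < tot a - u₂ → ¬ tot a - u₂ < a * (a + 1)) :
    HasHomology b p u₁ u₂ 0 := by
  refine hasHomology_of_test hp ![] (fun Φ hΦ _ => ?_) (fun _ _ i => i.elim0)
    fun y => ⟨0, Submodule.zero_mem _, fun i => i.elim0⟩
  exact hΦ.exists_cochain ha (fun h h' h'' => absurd h'' (h1 h h'))
    fun h h' h'' => absurd h'' (h2 h h')

end
end SegreCross

namespace SegreCross

section Monomials
variable (k : Type*) [Field k] (d : ℕ)

lemma monEl_coe {d e : ℕ} {m : Fin 4 → ℕ} (h : m 0 + m 1 = d ∧ m 2 + m 3 = e) :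
    (monEl k d e m : MvPolynomial (Fin 4) k) =
      MvPolynomial.monomial (Finsupp.equivFunOnFinite.symm m) 1 := by
  rw [monEl, dif_pos h]

/-- The exponents of the monomials of bidegree `(d, d)`. -/
def expo (y : Fin (d + 1) × Fin (d + 1)) : Fin 4 → ℕ := ![y.1, d - y.1, y.2, d - y.2]

lemma expo_deg (y : Fin (d + 1) × Fin (d + 1)) :
    expo d y 0 + expo d y 1 = d ∧ expo d y 2 + expo d y 3 = d := by
  have := y.1.2
  have := y.2.2
  simp [expo]
  omega

lemma expo_injective : Function.Injective (expo d) := by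
  intro y y' h
  have h0 := congrFun h 0
  have h2 := congrFun h 2
  simp [expo] at h0 h2
  exact Prod.ext (Fin.ext h0) (Fin.ext h2)

lemma exists_expo {m : Fin 4 → ℕ} (h : m 0 + m 1 = d ∧ m 2 + m 3 = d) :
    ∃ y : Fin (d + 1) × Fin (d + 1), m = expo d y ∧ m 0 = y.1 ∧ m 2 = y.2 := by
  refine ⟨(⟨m 0, by omega⟩, ⟨m 2, by omega⟩), ?_, rfl, rfl⟩
  ext i
  fin_cases i <;> simp [expo] <;> omega

/-- The monomial basis in bidegree `(d, d)`. -/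
def monBasis : Module.Basis (Fin (d + 1) × Fin (d + 1)) k (Bihom k d d) := by
  refine Module.Basis.mk (v := fun y => monEl k d d (expo d y)) ?_ ?_
  · rw [← LinearMap.linearIndependent_iff_of_injOn (Bihom k d d).subtype
      (Subtype.val_injective.injOn)]
    have h := (MvPolynomial.basisMonomials (Fin 4) k).linearIndependent.comp
      (fun y => Finsupp.equivFunOnFinite.symm (expo d y))
      (Finsupp.equivFunOnFinite.symm.injective.comp (expo_injective d))
    have e : (Bihom k d d).subtype ∘ (fun y => monEl k d d (expo d y)) =
        MvPolynomial.basisMonomials (Fin 4) k ∘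
          fun y => Finsupp.equivFunOnFinite.symm (expo d y) := by
      funext y
      simp [monEl_coe k (expo_deg d y)]
    rw [e]
    exact h
  · rintro ⟨f, hf⟩ -
    have e : (⟨f, hf⟩ : Bihom k d d) =
        ∑ m ∈ f.support, f.coeff m • monEl k d d m := by
      apply Subtype.ext
      rw [AddSubmonoidClass.coe_finsetSum]
      refine (MvPolynomial.as_sum f).trans ?_
      refine Finset.sum_congr rfl fun m hm => ?_
      rw [Submodule.coe_smul, monEl_coe k (hf m hm), MvPolynomial.smul_monomial, smul_eq_mul,
        mul_one]
      exact congrArg (fun s => MvPolynomial.monomial s (f.coeff m))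
        (Finsupp.equivFunOnFinite.symm_apply_apply m).symm
    rw [e]
    refine Submodule.sum_mem _ fun m hm => Submodule.smul_mem _ _ (Submodule.subset_span ?_)
    obtain ⟨y, hy, -⟩ := exists_expo d (hf m hm)
    exact ⟨y, by simp only [← hy]⟩

lemma monBasis_apply (y) : monBasis k d y = monEl k d d (expo d y) := by
  rw [monBasis, Module.Basis.mk_apply]

/-- The monomial basis of the degree one part. -/
def gridBasis (a : ℕ) : Module.Basis (Pt a) k (RS k a a 1) :=
  (monBasis k (1 * a)).reindex
    ((finCongr (by rw [one_mul])).prodCongr (finCongr (by rw [one_mul])))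

lemma gridBasis_apply (a : ℕ) (g : Pt a) : gridBasis k a g =
    monEl k (1 * a) (1 * a) ![g.1, a - g.1, g.2, a - g.2] := by
  rw [gridBasis, Module.Basis.reindex_apply, monBasis_apply]
  simp [expo]

lemma segMul_gridBasis (a q : ℕ) (g : Pt a) (y : Fin (q * a + 1) × Fin (q * a + 1)) :
    ∃ y' : Fin ((q + 1) * a + 1) × Fin ((q + 1) * a + 1),
      (y'.1 : ℕ) = g.1 + y.1 ∧ (y'.2 : ℕ) = g.2 + y.2 ∧
      segMul k a a q (gridBasis k a g) (monBasis k (q * a) y) = monBasis k ((q + 1) * a) y' := by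
  have h1 := g.1.2
  have h2 := g.2.2
  have h3 := y.1.2
  have h4 := y.2.2
  have e := add_mul q 1 a
  rw [one_mul] at e
  refine ⟨(⟨g.1 + y.1, by omega⟩, ⟨g.2 + y.2, by omega⟩), rfl, rfl, ?_⟩
  apply Subtype.ext
  rw [monBasis_apply, monBasis_apply, gridBasis_apply, monEl_coe k (expo_deg _ _)]
  change (monEl k _ _ _ : MvPolynomial (Fin 4) k) * (monEl k _ _ _ : MvPolynomial (Fin 4) k) = _
  rw [monEl_coe k (expo_deg _ _), monEl_coe, MvPolynomial.monomial_mul, one_mul]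
  · refine congrArg (fun s => MvPolynomial.monomial s (1 : k)) (Finsupp.ext fun i => ?_)
    fin_cases i <;> simp [expo, e] <;> omega
  · simp
    omega

end Monomials

section Wedge
variable {k V : Type*} [Field k] [AddCommGroup V] [Module k V] {I : Type*}

lemma coe_wedge (e : I → V) (p : ℕ) (v : Fin p → I) :
    (wedge k p (e ∘ v) : ExteriorAlgebra k V) = lp k e (List.ofFn v) := by
  rw [lp_eq_ιMulti]
  rfl

lemma span_wedge (b : Module.Basis I k V) (p : ℕ) :
    Submodule.span k (Set.range fun v : Fin p → I => wedge k p (b ∘ v)) = ⊤ := by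
  apply Submodule.map_injective_of_injective (⋀[k]^p V).injective_subtype
  rw [Submodule.map_span, Submodule.map_subtype_top]
  change _ = LinearMap.range (ExteriorAlgebra.ι k (M := V)) ^ p
  have e : LinearMap.range (ExteriorAlgebra.ι k (M := V)) =
      Submodule.span k (Set.range fun g => ExteriorAlgebra.ι k (b g)) := by
    rw [LinearMap.range_eq_map, ← b.span_eq, Submodule.map_span, ← Set.range_comp]
    rfl
  rw [e, Submodule.span_pow]
  congr 1
  ext x
  rw [Set.mem_pow]
  constructor
  · rintro ⟨_, ⟨v, rfl⟩, rfl⟩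
    refine ⟨fun i => ⟨_, v i, rfl⟩, ?_⟩
    change _ = (wedge k p (b ∘ v) : ExteriorAlgebra k V)
    rw [coe_wedge, lp, List.map_ofFn]
    rfl
  · rintro ⟨f, rfl⟩
    choose v hv using fun i => (f i).2
    refine ⟨_, ⟨v, rfl⟩, ?_⟩
    change (wedge k p (b ∘ v) : ExteriorAlgebra k V) = _
    rw [coe_wedge, lp, List.map_ofFn]
    congr 2
    funext i
    exact hv i

lemma span_wedge_tmul {J N : Type*} [AddCommGroup N] [Module k N] (b : Module.Basis I k V)
    (c : Module.Basis J k N) (p : ℕ) :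
    Submodule.span k {x | ∃ (v : Fin p → I) (y : J), x = wedge k p (b ∘ v) ⊗ₜ[k] c y} = ⊤ := by
  rw [← TensorProduct.map₂_mk_top_top_eq_top, ← span_wedge b p, ← c.span_eq,
    Submodule.map₂_span_span]
  congr 1
  ext x
  constructor
  · rintro ⟨v, y, rfl⟩
    exact ⟨_, ⟨v, rfl⟩, _, ⟨y, rfl⟩, rfl⟩
  · rintro ⟨_, ⟨v, rfl⟩, _, ⟨y, rfl⟩, rfl⟩
    exact ⟨v, y, rfl⟩

lemma ctr_lp_ofFn (d : Module.Dual k V) (e : I → V) (n : ℕ) (v : Fin (n + 1) → I) :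
    ctr d (lp k e (List.ofFn v)) = ∑ i : Fin (n + 1), ((-1 : k) ^ (i : ℕ) * d (e (v i))) •
      lp k e (List.ofFn fun j => v (i.succAbove j)) := by
  induction n with
  | zero => simp [ctr_lp_cons, ctr_one]
  | succ n ih =>
    conv_rhs => rw [Fin.sum_univ_succ]
    rw [List.ofFn_succ, ctr_lp_cons, ih, Finset.mul_sum, sub_eq_add_neg,
      ← Finset.sum_neg_distrib]
    congr 1
    · simp
    · refine Finset.sum_congr rfl fun i _ => ?_
      rw [List.ofFn_succ (f := fun j => v (i.succ.succAbove j)), lp_cons, mul_smul_comm, ← neg_smul]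
      simp [pow_succ]

end Wedge

end SegreCross

namespace SegreCross

section Weights
variable {k V : Type*} [Field k] [AddCommGroup V] [Module k V] {a : ℕ}

lemma exists_weightProj (b : Module.Basis (Pt a) k V) (s₁ s₂ : ℤ) :
    ∃ P : ExteriorAlgebra k V →ₗ[k] ExteriorAlgebra k V,
      ∀ S, P (lp k b S) = if sc S = s₁ ∧ sr S = s₂ then lp k b S else 0 := by
  classical
  let : LinearOrder (Pt a) := LinearOrder.lift' toLex toLex.injective
  refine ⟨b.ExteriorAlgebra.constr k fun F =>
    if ∑ g ∈ F, ((g.1 : ℕ) : ℤ) = s₁ ∧ ∑ g ∈ F, ((g.2 : ℕ) : ℤ) = s₂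
      then b.ExteriorAlgebra F else 0, fun S => ?_⟩
  by_cases hnd : S.Nodup
  · obtain ⟨s, -, e⟩ := exists_lp_eq_basis b hnd (F := S.toFinset) (by simp)
    rw [e, map_smul, Module.Basis.constr_basis, List.sum_toFinset _ hnd, List.sum_toFinset _ hnd,
      smul_ite, smul_zero]
    rfl
  · simp [lp_eq_zero_of_not_nodup _ hnd]

/-- The projection of the exterior algebra to the part of weight `(s₁, s₂)`. -/
def weightProj (b : Module.Basis (Pt a) k V) (s₁ s₂ : ℤ) :
    ExteriorAlgebra k V →ₗ[k] ExteriorAlgebra k V := (exists_weightProj b s₁ s₂).choose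

lemma weightProj_lp (b : Module.Basis (Pt a) k V) (s₁ s₂ : ℤ) (S) :
    weightProj b s₁ s₂ (lp k b S) = if sc S = s₁ ∧ sr S = s₂ then lp k b S else 0 :=
  (exists_weightProj b s₁ s₂).choose_spec S

variable {N : Type*} [AddCommGroup N] [Module k N] {d : ℕ}

/-- The part of total weight `(u₁, u₂)` of `Λᵖ V ⊗ N`. -/
def weightSpace (b : Module.Basis (Pt a) k V) (c : Module.Basis (Fin (d + 1) × Fin (d + 1)) k N)
    (p : ℕ) (u₁ u₂ : ℤ) : Submodule k (⋀[k]^p V ⊗[k] N) :=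
  Submodule.span k {x | ∃ (v : Fin p → Pt a) (y : Fin (d + 1) × Fin (d + 1)),
    sc (List.ofFn v) + (y.1 : ℕ) = u₁ ∧ sr (List.ofFn v) + (y.2 : ℕ) = u₂ ∧
    x = wedge k p (b ∘ v) ⊗ₜ[k] c y}

/-- The map `Λᵖ V ⊗ N → Λ V` projecting to total weight `(u₁, u₂)` and forgetting the second
factor. -/
def forget (b : Module.Basis (Pt a) k V) (c : Module.Basis (Fin (d + 1) × Fin (d + 1)) k N)
    (p : ℕ) (u₁ u₂ : ℤ) : ⋀[k]^p V ⊗[k] N →ₗ[k] ExteriorAlgebra k V :=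
  ∑ y, (TensorProduct.rid k (ExteriorAlgebra k V)).toLinearMap ∘ₗ
    TensorProduct.map (weightProj b (u₁ - (y.1 : ℕ)) (u₂ - (y.2 : ℕ)) ∘ₗ (⋀[k]^p V).subtype)
      (c.coord y)

/-- The section of `forget`. -/
def remember (b : Module.Basis (Pt a) k V) (c : Module.Basis (Fin (d + 1) × Fin (d + 1)) k N)
    (u₁ u₂ : ℤ) : ExteriorAlgebra k V →ₗ[k] ExteriorAlgebra k V ⊗[k] N :=
  ∑ y, (TensorProduct.mk k _ N).flip (c y) ∘ₗ
    weightProj b (u₁ - (y.1 : ℕ)) (u₂ - (y.2 : ℕ))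

variable (b : Module.Basis (Pt a) k V) (c : Module.Basis (Fin (d + 1) × Fin (d + 1)) k N)
  (p : ℕ) (u₁ u₂ : ℤ)

lemma forget_tmul (v : Fin p → Pt a) (y) : forget b c p u₁ u₂ (wedge k p (b ∘ v) ⊗ₜ[k] c y) =
    if sc (List.ofFn v) + (y.1 : ℕ) = u₁ ∧ sr (List.ofFn v) + (y.2 : ℕ) = u₂
      then lp k b (List.ofFn v) else 0 := by
  rw [forget, LinearMap.sum_apply, Finset.sum_eq_single y]
  · simp [coe_wedge, weightProj_lp, eq_sub_iff_add_eq]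
  · intro y' _ hne
    simp [hne.symm]
  · simp

lemma remember_lp (S : List (Pt a)) (y : Fin (d + 1) × Fin (d + 1))
    (h1 : sc S + (y.1 : ℕ) = u₁) (h2 : sr S + (y.2 : ℕ) = u₂) :
    remember b c u₁ u₂ (lp k b S) = lp k b S ⊗ₜ[k] c y := by
  rw [remember, LinearMap.sum_apply, Finset.sum_eq_single y]
  · simp [weightProj_lp, ← h1, ← h2]
  · intro y' _ hne
    rw [LinearMap.comp_apply, weightProj_lp, if_neg, map_zero]
    rintro ⟨h3, h4⟩
    exact hne (Prod.ext (Fin.ext (by omega)) (Fin.ext (by omega)))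
  · simp

variable {p u₁ u₂}

lemma remember_forget {x} (hx : x ∈ weightSpace b c p u₁ u₂) :
    remember b c u₁ u₂ (forget b c p u₁ u₂ x) = (⋀[k]^p V).subtype.rTensor N x := by
  rw [weightSpace] at hx
  induction hx using Submodule.span_induction with
  | mem x hx =>
    obtain ⟨v, y, h1, h2, rfl⟩ := hx
    rw [forget_tmul, if_pos ⟨h1, h2⟩, remember_lp b c _ _ _ y h1 h2, LinearMap.rTensor_tmul,
      Submodule.subtype_apply, coe_wedge]
  | zero => simp
  | add x y _ _ hx hy => rw [map_add, map_add, hx, hy, map_add]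
  | smul r x _ hx => rw [map_smul, map_smul, hx, map_smul]

lemma eq_zero_of_forget {x} (hx : x ∈ weightSpace b c p u₁ u₂)
    (h : forget b c p u₁ u₂ x = 0) : x = 0 := by
  apply Module.Flat.rTensor_preserves_injective_linearMap (M := N) _
    (⋀[k]^p V).injective_subtype
  rw [← remember_forget b c hx, h, map_zero, map_zero]

variable (p u₁ u₂) in
lemma forget_mem_chains {q : ℕ} (hd : d = q * a) (x) :
    forget b c p u₁ u₂ x ∈ chains b p q u₁ u₂ := by
  have hx : x ∈ (⊤ : Submodule k (⋀[k]^p V ⊗[k] N)) := trivial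
  rw [← span_wedge_tmul b c p] at hx
  induction hx using Submodule.span_induction with
  | mem x hx =>
    obtain ⟨v, y, rfl⟩ := hx
    rw [forget_tmul]
    split_ifs with h
    · have := y.1.2
      have := y.2.2
      have : (d : ℤ) = q * a := mod_cast hd
      exact Submodule.subset_span ⟨_, by simp, by omega, by omega, by omega, by omega, rfl⟩
    · exact zero_mem _
  | zero => simp
  | add x y _ _ hx hy => exact map_add (forget b c p u₁ u₂) x y ▸ add_mem hx hy
  | smul r x _ hx => exact map_smul (forget b c p u₁ u₂) r x ▸ Submodule.smul_mem _ _ hx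

lemma exists_forget_eq {q : ℕ} (hd : d = q * a) {w} (hw : w ∈ chains b p q u₁ u₂) :
    ∃ x ∈ weightSpace b c p u₁ u₂, forget b c p u₁ u₂ x = w := by
  rw [chains] at hw
  induction hw using Submodule.span_induction with
  | mem w hw =>
    obtain ⟨S, rfl, h1, h2, h3, h4, rfl⟩ := hw
    have : (d : ℤ) = q * a := mod_cast hd
    have e : List.ofFn S.get = S := List.ofFn_get S
    have e1 : sc (List.ofFn S.get) + ((u₁ - sc S).toNat : ℕ) = u₁ := by
      rw [e]
      omega
    have e2 : sr (List.ofFn S.get) + ((u₂ - sr S).toNat : ℕ) = u₂ := by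
      rw [e]
      omega
    refine ⟨wedge k _ (b ∘ S.get) ⊗ₜ c (⟨(u₁ - sc S).toNat, by omega⟩,
      ⟨(u₂ - sr S).toNat, by omega⟩), Submodule.subset_span ⟨_, _, e1, e2, rfl⟩, ?_⟩
    rw [forget_tmul, if_pos ⟨e1, e2⟩, e]
  | zero => exact ⟨0, zero_mem _, map_zero _⟩
  | add w w' _ _ hw hw' =>
    obtain ⟨x, hx, rfl⟩ := hw
    obtain ⟨x', hx', rfl⟩ := hw'
    exact ⟨x + x', add_mem hx hx', map_add _ _ _⟩
  | smul r w _ hw =>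
    obtain ⟨x, hx, rfl⟩ := hw
    exact ⟨r • x, Submodule.smul_mem _ _ hx, map_smul _ _ _⟩

end Weights

section Koszul
variable {k : Type*} [Field k] {a : ℕ}

lemma fineComp_eq (p q : ℕ) (u₁ u₂ : ℤ) :
    fineComp k a a p q u₁ u₂ = weightSpace (gridBasis k a) (monBasis k (q * a)) p u₁ u₂ := by
  rw [fineComp, weightSpace]
  congr 1
  ext x
  constructor
  · rintro ⟨ij, m, hij, hm1, hm2, h1, h2, rfl⟩
    obtain ⟨y, hy, hy1, hy2⟩ := exists_expo (q * a) ⟨hm1, hm2⟩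
    refine ⟨fun t => (⟨(ij t).1, by have := hij t; omega⟩, ⟨(ij t).2, by have := hij t; omega⟩),
      y, ?_, ?_, ?_⟩
    · rw [← h1, hy1, sc, List.map_ofFn, List.sum_ofFn]
      rfl
    · rw [← h2, hy2, sr, List.map_ofFn, List.sum_ofFn]
      rfl
    · rw [monBasis_apply, ← hy]
      congr 2
      funext t
      rw [Function.comp_apply, gridBasis_apply]
  · rintro ⟨v, y, h1, h2, rfl⟩
    refine ⟨fun t => ((v t).1, (v t).2), expo (q * a) y, fun t => ?_, (expo_deg _ y).1,
      (expo_deg _ y).2, ?_, ?_, ?_⟩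
    · have := (v t).1.2
      have := (v t).2.2
      exact ⟨by simp only; omega, by simp only; omega⟩
    · rw [← h1, sc, List.map_ofFn, List.sum_ofFn]
      rfl
    · rw [← h2, sr, List.map_ofFn, List.sum_ofFn]
      rfl
    · rw [monBasis_apply]
      congr 2
      funext t
      exact gridBasis_apply k a _

lemma sc_succAbove {n : ℕ} (v : Fin (n + 1) → Pt a) (i) :
    sc (List.ofFn v) = (v i).1 + sc (List.ofFn fun j => v (i.succAbove j)) := by
  simp only [sc, List.map_ofFn, List.sum_ofFn]
  exact Fin.sum_univ_succAbove _ i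

lemma sr_succAbove {n : ℕ} (v : Fin (n + 1) → Pt a) (i) :
    sr (List.ofFn v) = (v i).2 + sr (List.ofFn fun j => v (i.succAbove j)) := by
  simp only [sr, List.map_ofFn, List.sum_ofFn]
  exact Fin.sum_univ_succAbove _ i

variable {δ : KoszulMaps k a a} {n q : ℕ} {u₁ u₂ : ℤ}

lemma koszul_mem_weightSpace (hδ : IsKoszul k a a δ) {x}
    (hx : x ∈ weightSpace (gridBasis k a) (monBasis k (q * a)) (n + 1) u₁ u₂) :
    δ n q x ∈ weightSpace (gridBasis k a) (monBasis k ((q + 1) * a)) n u₁ u₂ := by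
  rw [weightSpace] at hx
  induction hx using Submodule.span_induction with
  | mem x hx =>
    obtain ⟨v, y, h1, h2, rfl⟩ := hx
    rw [hδ]
    refine Submodule.sum_mem _ fun i _ => Submodule.smul_mem _ _ ?_
    obtain ⟨y', hy1, hy2, e⟩ := segMul_gridBasis k a q (v i) y
    refine Submodule.subset_span ⟨fun j => v (i.succAbove j), y', ?_, ?_, ?_⟩
    · rw [← h1, sc_succAbove v i, hy1]
      push_cast
      ring
    · rw [← h2, sr_succAbove v i, hy2]
      push_cast
      ring
    · rw [← e]
      rfl
  | zero => simp
  | add x y _ _ hx hy => exact map_add (δ n q) x y ▸ add_mem hx hy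
  | smul r x _ hx => exact map_smul (δ n q) r x ▸ Submodule.smul_mem _ _ hx

lemma forget_koszul (hδ : IsKoszul k a a δ) (x) :
    forget (gridBasis k a) (monBasis k ((q + 1) * a)) n u₁ u₂ (δ n q x) =
      ctr (aug (gridBasis k a))
        (forget (gridBasis k a) (monBasis k (q * a)) (n + 1) u₁ u₂ x) := by
  suffices h : forget (gridBasis k a) (monBasis k ((q + 1) * a)) n u₁ u₂ ∘ₗ δ n q =
      ctr (aug (gridBasis k a)) ∘ₗ
        forget (gridBasis k a) (monBasis k (q * a)) (n + 1) u₁ u₂ from LinearMap.congr_fun h x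
  refine LinearMap.ext_on (span_wedge_tmul (gridBasis k a) (monBasis k (q * a)) (n + 1)) ?_
  rintro _ ⟨v, y, rfl⟩
  rw [LinearMap.comp_apply, LinearMap.comp_apply, forget_tmul, hδ, map_sum,
    apply_ite (ctr (aug (gridBasis k a))), map_zero, ctr_lp_ofFn]
  have key : ∀ i : Fin (n + 1), forget (gridBasis k a) (monBasis k ((q + 1) * a)) n u₁ u₂
      (wedge k n (fun j => (gridBasis k a ∘ v) (i.succAbove j)) ⊗ₜ[k]
        segMul k a a q ((gridBasis k a ∘ v) i) (monBasis k (q * a) y)) =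
      if sc (List.ofFn v) + (y.1 : ℕ) = u₁ ∧ sr (List.ofFn v) + (y.2 : ℕ) = u₂
        then lp k (gridBasis k a) (List.ofFn fun j => v (i.succAbove j)) else 0 := by
    intro i
    obtain ⟨y', hy1, hy2, e⟩ := segMul_gridBasis k a q (v i) y
    rw [Function.comp_apply, e]
    refine (forget_tmul (gridBasis k a) (monBasis k ((q + 1) * a)) n u₁ u₂
      (fun j => v (i.succAbove j)) y').trans ?_
    rw [sc_succAbove v i, sr_succAbove v i, hy1, hy2]
    refine if_congr ?_ rfl rfl
    push_cast
    refine and_congr ?_ ?_ <;> constructor <;> intro <;> linarith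
  simp only [map_smul, key, aug_apply, mul_one]
  split_ifs <;> simp

end Koszul

section Quotient
variable {k W : Type*} [Field k] [AddCommGroup W] [Module k W]

lemma finrank_map_mkQ {Z R : Submodule k W} {r : ℕ} (L : W →ₗ[k] Fin r → k)
    (hL : ∀ z ∈ Z, L z = 0 ↔ z ∈ R) (hs : ∀ y, ∃ z ∈ Z, L z = y) :
    Module.finrank k (Z.map R.mkQ) = r := by
  have hk : LinearMap.ker (R.mkQ.domRestrict Z) = LinearMap.ker (L.domRestrict Z) := by
    ext z
    simp [hL z z.2]
  have hr : LinearMap.range (L.domRestrict Z) = ⊤ :=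
    LinearMap.range_eq_top.2 fun y => by
      obtain ⟨z, hz, e⟩ := hs y
      exact ⟨⟨z, hz⟩, e⟩
  rw [← LinearMap.range_domRestrict,
    ← (LinearMap.quotKerEquivRange (R.mkQ.domRestrict Z)).finrank_eq, hk,
    (LinearMap.quotKerEquivRange (L.domRestrict Z)).finrank_eq, hr, finrank_top,
    Module.finrank_fin_fun]

lemma map_mkQ_eq_bot {Z R : Submodule k W} (h : Z ≤ R) : Z.map R.mkQ = ⊥ := by
  rw [eq_bot_iff, Submodule.map_le_iff_le_comap]
  intro z hz
  simpa using h hz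

end Quotient

section Components
variable {k : Type*} [Field k] {a : ℕ} {δ : KoszulMaps k a a} {n r : ℕ} {u₁ u₂ : ℤ}

lemma exists_test (hδ : IsKoszul k a a δ)
    (h : HasHomology (gridBasis k a) (n + 1) u₁ u₂ r) :
    ∃ L : LinearMap.ker (δ n 1) →ₗ[k] Fin r → k,
      (∀ z ∈ Submodule.comap (LinearMap.ker (δ n 1)).subtype (fineComp k a a (n + 1) 1 u₁ u₂),
        L z = 0 ↔ z ∈ Submodule.comap (LinearMap.ker (δ n 1)).subtype
          (LinearMap.range (δ (n + 1) 0))) ∧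
      ∀ y, ∃ z ∈ Submodule.comap (LinearMap.ker (δ n 1)).subtype
        (fineComp k a a (n + 1) 1 u₁ u₂), L z = y := by
  obtain ⟨L, hL, hs⟩ := h
  refine ⟨L ∘ₗ forget (gridBasis k a) (monBasis k (1 * a)) (n + 1) u₁ u₂ ∘ₗ
    (LinearMap.ker (δ n 1)).subtype, ?_, fun y => ?_⟩
  · rintro ⟨z, hz⟩ hzf
    rw [Submodule.mem_comap, Submodule.subtype_apply, fineComp_eq] at hzf
    rw [Submodule.mem_comap, Submodule.subtype_apply]
    refine (hL _ (mem_cycles_iff.2 ⟨forget_mem_chains _ _ _ _ _ rfl z, ?_⟩)).trans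
      ⟨?_, ?_⟩
    · rw [← forget_koszul hδ, LinearMap.mem_ker.1 hz, map_zero]
    · rintro ⟨w, hw, e⟩
      obtain ⟨x, hx, rfl⟩ := exists_forget_eq _ (monBasis k (0 * a)) rfl hw
      refine ⟨x, ?_⟩
      rw [← sub_eq_zero]
      refine eq_zero_of_forget (gridBasis k a) (monBasis k (1 * a))
        (sub_mem (koszul_mem_weightSpace (q := 0) hδ hx) hzf) ?_
      rw [map_sub, sub_eq_zero]
      exact (forget_koszul (q := 0) hδ x).trans e
    · rintro ⟨x, hx⟩
      refine ⟨forget (gridBasis k a) (monBasis k (0 * a)) (n + 1 + 1) u₁ u₂ x,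
        forget_mem_chains _ _ _ _ _ rfl x, (forget_koszul (q := 0) hδ x).symm.trans ?_⟩
      exact congrArg _ hx
  · obtain ⟨c, hc, rfl⟩ := hs y
    obtain ⟨h1, h2⟩ := mem_cycles_iff.1 hc
    obtain ⟨z, hz, rfl⟩ := exists_forget_eq _ (monBasis k (1 * a)) rfl h1
    refine ⟨⟨z, LinearMap.mem_ker.2 (eq_zero_of_forget (gridBasis k a)
      (monBasis k ((1 + 1) * a)) (koszul_mem_weightSpace hδ hz) ?_)⟩, ?_, rfl⟩
    · rw [forget_koszul hδ, h2]
    · rw [Submodule.mem_comap, Submodule.subtype_apply, fineComp_eq]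
      exact hz

lemma finrank_Kp1Comp (hδ : IsKoszul k a a δ)
    (h : HasHomology (gridBasis k a) (n + 1) u₁ u₂ r) :
    Module.finrank k (Kp1Comp k a a δ n u₁ u₂) = r := by
  obtain ⟨L, hL, hs⟩ := exists_test hδ h
  exact finrank_map_mkQ L hL hs

lemma Kp1Comp_eq_bot (hδ : IsKoszul k a a δ)
    (h : HasHomology (gridBasis k a) (n + 1) u₁ u₂ 0) : Kp1Comp k a a δ n u₁ u₂ = ⊥ := by
  obtain ⟨L, hL, -⟩ := exists_test hδ h
  exact map_mkQ_eq_bot fun z hz => (hL z hz).1 (Subsingleton.elim _ _)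

end Components

end SegreCross

open SegreCross

/-- Let `a = b ≥ 3`, `p := a² + a − 1` (written `p = n+1`) and
`m := a²(a+1)/2` (i.e. `2m = a²(a+1)`), `c := a(a+1)/2` (i.e. `2c = a(a+1)`).
The fine-bidegree decomposition of `K_{p,1}` is a cross:
`dim K_{p,1}^{(m,m)} = 2`; `dim K_{p,1}^{(u,m)} = 1` for `0 < |u−m| < c`;
`dim K_{p,1}^{(m,v)} = 1` for `0 < |v−m| < c`; and all other components vanish. -/
theorem segre_bidegree_cross (k : Type*) [Field k] (a : ℕ) (ha : 3 ≤ a)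
    (δ : KoszulMaps k a a) (hδ : IsKoszul k a a δ)
    (n : ℕ) (hn : n + 1 = a * a + a - 1)
    (m c : ℕ) (hm : 2 * m = a * a * (a + 1)) (hc : 2 * c = a * (a + 1)) :
    Module.finrank k (Kp1Comp k a a δ n (m : ℤ) (m : ℤ)) = 2 ∧
    (∀ u : ℤ, u ≠ (m : ℤ) → |u - (m : ℤ)| < (c : ℤ) →
      Module.finrank k (Kp1Comp k a a δ n u (m : ℤ)) = 1) ∧
    (∀ v : ℤ, v ≠ (m : ℤ) → |v - (m : ℤ)| < (c : ℤ) →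
      Module.finrank k (Kp1Comp k a a δ n (m : ℤ) v) = 1) ∧
    (∀ u v : ℤ,
      ¬((u = (m : ℤ) ∧ v = (m : ℤ)) ∨
        (v = (m : ℤ) ∧ u ≠ (m : ℤ) ∧ |u - (m : ℤ)| < (c : ℤ)) ∨
        (u = (m : ℤ) ∧ v ≠ (m : ℤ) ∧ |v - (m : ℤ)| < (c : ℤ))) →
      Kp1Comp k a a δ n u v = ⊥) := by
  have hp : n + 1 + (a + 2) = (a + 1) * (a + 1) := by
    have : (a + 1) * (a + 1) = a * a + a + a + 1 := by ring
    omega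
  have ht : 2 * (tot a - m) = a * (a + 1) := by
    have h1 := two_mul_tot a
    have h2 : (2 * m : ℤ) = a * a * (a + 1) := mod_cast hm
    linear_combination h1 - h2
  have hc' : (2 * c : ℤ) = a * (a + 1) := mod_cast hc
  rw [← hc'] at ht
  refine ⟨?_, ?_, ?_, ?_⟩
  · exact finrank_Kp1Comp hδ (hasHomology_two ha hp (by omega) (by omega))
  · intro u hu hlt
    rw [abs_lt] at hlt
    exact finrank_Kp1Comp hδ
      (hasHomology_row ha hp (by omega) (by omega) (by omega) (by omega))
  · intro v hv hlt
    rw [abs_lt] at hlt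
    exact finrank_Kp1Comp hδ
      (hasHomology_column ha hp (by omega) (by omega) (by omega) (by omega))
  · intro u v h
    rw [abs_lt, abs_lt] at h
    exact Kp1Comp_eq_bot hδ
      (hasHomology_zero ha hp (by omega) (by omega))

end
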